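/- arXiv:1604.05192 — 2 statements merged into one kernel-verified Lean document; each statement's English description precedes it below -/
import Mathlib

section
/- For every non-computable left-c.e. real α there exists a left-c.e. real β such that for all left-c.e. reals γ and all right-c.e. reals γ', α ≠ β + γ and α ≠ β + γ'. -/
open Filter

/-- A real is left-c.e. if it is the limit of an increasing computable sequence of rationals. -/
def LeftCE (α : ℝ) : Prop :=
  ∃ f : ℕ → ℚ, Computable f ∧ StrictMono f ∧
    Tendsto (fun n => (f n : ℝ)) atTop (nhds α)

/-- A real is right-c.e. if it is the limit of a decreasing computable sequence of rationals. -/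
def RightCE (α : ℝ) : Prop :=
  ∃ f : ℕ → ℚ, Computable f ∧ StrictAnti f ∧
    Tendsto (fun n => (f n : ℝ)) atTop (nhds α)

/-- A real is computable if a computable sequence of rationals approximates it with error `2⁻ⁿ`. -/
def ComputableReal (α : ℝ) : Prop :=
  ∃ f : ℕ → ℚ, Computable f ∧ ∀ n, |(f n : ℝ) - α| < (2 : ℝ)⁻¹ ^ n

/-- Martin-Löf randomness of a real, via interval Martin-Löf tests: a test is a computable
double sequence of rational intervals, where level `n` has total length at most `2⁻ⁿ`;
a random real escapes some level of every test. -/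
def MLRandom (α : ℝ) : Prop :=
  ∀ U : ℕ → ℕ → ℚ × ℚ, Computable₂ U →
    (∀ n : ℕ, ∑' i : ℕ, max (((U n i).2 : ℝ) - ((U n i).1 : ℝ)) 0 ≤ (2 : ℝ)⁻¹ ^ n) →
    ∃ n : ℕ, ∀ i : ℕ, ¬ (((U n i).1 : ℝ) < α ∧ α < ((U n i).2 : ℝ))

/-- A set of naturals is computably enumerable. -/
def CESet (A : Set ℕ) : Prop :=
  ∃ f : ℕ →. ℕ, Partrec f ∧ ∀ n, n ∈ A ↔ (f n).Dom

/-- The real in [0,1] whose binary expansion is the characteristic sequence of `A`. -/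
noncomputable def realOfSet (A : Set ℕ) : ℝ :=
  ∑' n : ℕ, Set.indicator A (fun n => (2 : ℝ)⁻¹ ^ (n + 1)) n


namespace RatComp

/-- raw code of a rational -/
def code (q : ℚ) : ℕ := Nat.pair (Equiv.intEquivNat q.num) q.den

/-- the set of raw codes -/
def IsCode (x : ℕ) : Prop :=
  0 < x.unpair.2 ∧ ∀ k < x.unpair.2 + 1, (((x.unpair.1 + 1) / 2) % k = 0 ∧ x.unpair.2 % k = 0) → k = 1

instance : DecidablePred IsCode := fun x => by unfold IsCode; infer_instance

theorem natAbs_intEquivNat (z : ℤ) : (Equiv.intEquivNat z + 1) / 2 = z.natAbs := by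
  cases z with
  | ofNat n => 
    have : Equiv.intEquivNat (Int.ofNat n) = 2 * n := rfl
    rw [this]; simp; omega
  | negSucc n => 
    have : Equiv.intEquivNat (Int.negSucc n) = 2 * n + 1 := rfl
    rw [this]; simp; omega

theorem isCode_iff (x : ℕ) : IsCode x ↔ ∃ q, code q = x := by
  constructor
  · rintro ⟨h1, h2⟩
    have hz := natAbs_intEquivNat (Equiv.intEquivNat.symm x.unpair.1)
    rw [Equiv.apply_symm_apply] at hz
    refine ⟨⟨Equiv.intEquivNat.symm x.unpair.1, x.unpair.2, h1.ne', ?_⟩, ?_⟩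
    · rw [← hz]
      refine h2 _ (Nat.lt_succ_of_le (Nat.gcd_le_right _ h1)) ⟨?_, ?_⟩
      · exact Nat.mod_eq_zero_of_dvd (Nat.gcd_dvd_left _ _)
      · exact Nat.mod_eq_zero_of_dvd (Nat.gcd_dvd_right _ _)
    · simp [code]
  · rintro ⟨q, rfl⟩
    simp only [IsCode, code, Nat.unpair_pair, natAbs_intEquivNat]
    refine ⟨q.den_pos, fun k _ ⟨h1, h2⟩ => ?_⟩
    exact Nat.eq_one_of_dvd_coprimes q.reduced (Nat.dvd_of_mod_eq_zero h1) (Nat.dvd_of_mod_eq_zero h2)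

theorem code_inj {p q : ℚ} (h : code p = code q) : p = q := by
  simp only [code, Nat.pair_eq_pair, EmbeddingLike.apply_eq_iff_eq] at h
  exact Rat.ext h.1 h.2

theorem code_eq (q : ℚ) : @Encodable.encode ℚ Rat.instEncodable q = code q := rfl

theorem encode_eq (q : ℚ) : @Encodable.encode ℚ Primcodable.toEncodable q =
    ((List.range (code q)).filter (fun y => IsCode y)).length := by
  have h : @Encodable.encode ℚ Primcodable.toEncodable q =
    @List.countP ℕ (fun y => @decide (y ∈ Set.range (@Encodable.encode ℚ Rat.instEncodable)) (@Encodable.decidableRangeEncode ℚ Rat.instEncodable y)) (List.range (code q)) := rfl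
  rw [h, List.countP_eq_length_filter]
  congr 2
  ext y
  rw [decide_eq_decide, isCode_iff]
  rfl

theorem primrec_isCode : PrimrecPred IsCode := by
  unfold IsCode
  have hu2 : Primrec (fun x : ℕ => x.unpair.2) := Primrec.snd.comp Primrec.unpair
  have hu1 : Primrec (fun x : ℕ => (x.unpair.1 + 1) / 2) :=
    Primrec.nat_div.comp (Primrec.succ.comp (Primrec.fst.comp Primrec.unpair)) (Primrec.const 2)
  refine PrimrecPred.and (Primrec.nat_lt.comp (Primrec.const 0) hu2) ?_
  have hR : PrimrecRel (fun k x : ℕ => (((x.unpair.1 + 1) / 2) % k = 0 ∧ x.unpair.2 % k = 0) → k = 1) := by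
    have : PrimrecRel (fun k x : ℕ => ¬ (((x.unpair.1 + 1) / 2) % k = 0 ∧ x.unpair.2 % k = 0) ∨ k = 1) := by
      refine PrimrecPred.or (PrimrecPred.not (PrimrecPred.and ?_ ?_)) ?_
      · exact Primrec.eq.comp (Primrec.nat_mod.comp (hu1.comp Primrec.snd) Primrec.fst) (Primrec.const 0)
      · exact Primrec.eq.comp (Primrec.nat_mod.comp (hu2.comp Primrec.snd) Primrec.fst) (Primrec.const 0)
      · exact Primrec.eq.comp Primrec.fst (Primrec.const 1)
    exact this.of_eq (fun a b => imp_iff_not_or.symm)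
  exact hR.forall_lt.comp (Primrec.succ.comp hu2) Primrec.id

theorem computable_code : Computable code := by
  have hb : Computable₂ (fun (q : ℚ) (x : ℕ) =>
      decide (IsCode x ∧ ((List.range x).filter (fun y => IsCode y)).length = @Encodable.encode ℚ Primcodable.toEncodable q)) := by
    refine Primrec.to_comp (α := ℚ × ℕ) ?_
    refine Primrec.of_eq ((Primrec.and).comp (g := fun x : ℚ × ℕ => decide (IsCode x.2)) (h := fun x : ℚ × ℕ => decide (((List.range x.2).filter (fun y => IsCode y)).length = @Encodable.encode ℚ Primcodable.toEncodable x.1)) ?_ ?_) (fun _ => (Bool.decide_and _ _).symm)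
    · exact primrec_isCode.decide.comp Primrec.snd
    · exact (Primrec.eq.comp (Primrec.list_length.comp ((Primrec.listFilter primrec_isCode).comp (Primrec.list_range.comp Primrec.snd)))
        (Primrec.encode.comp Primrec.fst)).decide
  refine (Partrec.rfind hb.partrec₂).of_eq_tot (fun q => ?_)
  rw [Nat.mem_rfind]
  refine ⟨?_, fun {m} hm => ?_⟩
  · simp [← encode_eq, isCode_iff]
  · simp only [PFun.coe_val, Part.mem_some_iff]
    rw [eq_comm, decide_eq_false_iff_not]
    rintro ⟨h1, h2⟩
    obtain ⟨q', rfl⟩ := (isCode_iff m).1 h1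
    rw [← encode_eq] at h2
    have := @Encodable.encode_injective ℚ Primcodable.toEncodable _ _ h2
    subst this
    exact lt_irrefl _ hm

/-- positive part of numerator -/
def P (q : ℚ) : ℕ := q.num.toNat
def N (q : ℚ) : ℕ := (-q.num).toNat
def D (q : ℚ) : ℕ := q.den

theorem D_pos (q : ℚ) : 0 < D q := q.den_pos
theorem eq_PND (q : ℚ) : q = ((P q : ℚ) - N q) / D q := by
  have : ((P q : ℚ) - N q) = (q.num : ℚ) := by
    have h := Int.toNat_sub_toNat_neg q.num
    unfold P N
    exact_mod_cast congrArg (Int.cast : ℤ → ℚ) h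
  rw [this, D, Rat.num_div_den]

theorem P_eq (q : ℚ) : P q = if (code q).unpair.1 % 2 = 0 then (code q).unpair.1 / 2 else 0 := by
  unfold P code
  rw [Nat.unpair_pair]
  cases q.num with
  | ofNat n => 
    have : Equiv.intEquivNat (Int.ofNat n) = 2 * n := rfl
    rw [this]; simp
  | negSucc n => 
    have : Equiv.intEquivNat (Int.negSucc n) = 2 * n + 1 := rfl
    rw [this]; simp
theorem N_eq (q : ℚ) : N q = if (code q).unpair.1 % 2 = 0 then 0 else ((code q).unpair.1 + 1) / 2 := by
  unfold N code
  rw [Nat.unpair_pair]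
  cases q.num with
  | ofNat n => 
    have : Equiv.intEquivNat (Int.ofNat n) = 2 * n := rfl
    rw [this]; simp
  | negSucc n => 
    have : Equiv.intEquivNat (Int.negSucc n) = 2 * n + 1 := rfl
    rw [this]; simp; omega

theorem compD : Computable D := by
  refine ((Computable.snd.comp (Computable.unpair.comp computable_code))).of_eq (fun q => ?_)
  simp [code, D]
theorem compP : Computable P := by
  have h : Primrec (fun x : ℕ => if x.unpair.1 % 2 = 0 then x.unpair.1 / 2 else 0) := by
    have h1 : Primrec (fun x : ℕ => x.unpair.1) := Primrec.fst.comp Primrec.unpair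
    exact Primrec.ite (Primrec.eq.comp (Primrec.nat_mod.comp h1 (Primrec.const 2)) (Primrec.const 0))
      (Primrec.nat_div.comp h1 (Primrec.const 2)) (Primrec.const 0)
  exact (h.to_comp.comp computable_code).of_eq (fun q => (P_eq q).symm)
theorem compN : Computable N := by
  have h : Primrec (fun x : ℕ => if x.unpair.1 % 2 = 0 then 0 else (x.unpair.1 + 1) / 2) := by
    have h1 : Primrec (fun x : ℕ => x.unpair.1) := Primrec.fst.comp Primrec.unpair
    exact Primrec.ite (Primrec.eq.comp (Primrec.nat_mod.comp h1 (Primrec.const 2)) (Primrec.const 0))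
       (Primrec.const 0) (Primrec.nat_div.comp (Primrec.succ.comp h1) (Primrec.const 2))
  exact (h.to_comp.comp computable_code).of_eq (fun q => (N_eq q).symm)

variable {A : Type*} [Primcodable A]

theorem nadd {f g : A → ℕ} (hf : Computable f) (hg : Computable g) : Computable (fun a => f a + g a) :=
  Computable₂.comp (Primrec.nat_add.to_comp) hf hg
theorem nmul {f g : A → ℕ} (hf : Computable f) (hg : Computable g) : Computable (fun a => f a * g a) :=
  Computable₂.comp (Primrec.nat_mul.to_comp) hf hg
theorem neqd {f g : A → ℕ} (hf : Computable f) (hg : Computable g) : Computable (fun a => decide (f a = g a)) :=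
  Computable₂.comp (Primrec.eq.decide.to_comp) hf hg
theorem nltd {f g : A → ℕ} (hf : Computable f) (hg : Computable g) : Computable (fun a => decide (f a < g a)) :=
  Computable₂.comp (Primrec.nat_lt.decide.to_comp) hf hg

theorem mk {F : A → ℚ} {p n d : A → ℕ} (hp : Computable p) (hn : Computable n) (hd : Computable d)
    (h0 : ∀ a, 0 < d a) (hF : ∀ a, F a = ((p a : ℚ) - n a) / d a) : Computable F := by
  have key : ∀ a (q : ℚ), p a * D q + N q * d a = n a * D q + P q * d a ↔ q = F a := by
    intro a q
    have h1 : (D q : ℚ) ≠ 0 := by exact_mod_cast (D_pos q).ne'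
    have h2 : (d a : ℚ) ≠ 0 := by exact_mod_cast (h0 a).ne'
    conv_rhs => rw [eq_PND q, hF, div_eq_div_iff h1 h2]
    constructor
    · intro h
      have h : (p a * D q + N q * d a : ℚ) = n a * D q + P q * d a := by exact_mod_cast h
      linarith
    · intro h
      have h : (p a * D q + N q * d a : ℚ) = n a * D q + P q * d a := by linarith
      exact_mod_cast h
  have hb : Computable₂ (fun (a : A) (m : ℕ) =>
      decide (p a * D (Denumerable.ofNat ℚ m) + N (Denumerable.ofNat ℚ m) * d a
        = n a * D (Denumerable.ofNat ℚ m) + P (Denumerable.ofNat ℚ m) * d a)) := by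
    have ho : Computable (fun x : A × ℕ => Denumerable.ofNat ℚ x.2) := (Computable.ofNat ℚ).comp Computable.snd
    exact neqd (nadd (nmul (hp.comp Computable.fst) (compD.comp ho)) (nmul (compN.comp ho) (hd.comp Computable.fst)))
      (nadd (nmul (hn.comp Computable.fst) (compD.comp ho)) (nmul (compP.comp ho) (hd.comp Computable.fst)))
  refine Computable.encode_iff.1 ((Partrec.rfind hb.partrec₂).of_eq_tot (fun a => ?_))
  rw [Nat.mem_rfind]
  refine ⟨?_, fun {m} hm => ?_⟩
  · have := (key a (F a)).2 rfl
    rw [← Denumerable.ofNat_encode (F a)] at this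
    simp only [PFun.coe_val, Part.mem_some_iff]
    exact (decide_eq_true this).symm
  · simp only [PFun.coe_val, Part.mem_some_iff]
    rw [eq_comm, decide_eq_false_iff_not, key]
    intro h
    rw [← h] at hm
    have h3 := Denumerable.encode_ofNat (α := ℚ) m
    exact lt_irrefl m (hm.trans_eq h3)

theorem add {f g : A → ℚ} (hf : Computable f) (hg : Computable g) : Computable (fun a => f a + g a) := by
  refine mk (p := fun a => P (f a) * D (g a) + P (g a) * D (f a)) (n := fun a => N (f a) * D (g a) + N (g a) * D (f a))
    (d := fun a => D (f a) * D (g a)) ?_ ?_ ?_ (fun a => Nat.mul_pos (D_pos _) (D_pos _)) (fun a => ?_)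
  · exact nadd (nmul (compP.comp hf) (compD.comp hg)) (nmul (compP.comp hg) (compD.comp hf))
  · exact nadd (nmul (compN.comp hf) (compD.comp hg)) (nmul (compN.comp hg) (compD.comp hf))
  · exact nmul (compD.comp hf) (compD.comp hg)
  · have h1 : (D (f a) : ℚ) ≠ 0 := by exact_mod_cast (D_pos _).ne'
    have h2 : (D (g a) : ℚ) ≠ 0 := by exact_mod_cast (D_pos _).ne'
    conv_lhs => rw [eq_PND (f a), eq_PND (g a)]
    push_cast
    field_simp
    ring

theorem mul {f g : A → ℚ} (hf : Computable f) (hg : Computable g) : Computable (fun a => f a * g a) := by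
  refine mk (p := fun a => P (f a) * P (g a) + N (f a) * N (g a)) (n := fun a => P (f a) * N (g a) + N (f a) * P (g a))
    (d := fun a => D (f a) * D (g a)) ?_ ?_ ?_ (fun a => Nat.mul_pos (D_pos _) (D_pos _)) (fun a => ?_)
  · exact nadd (nmul (compP.comp hf) (compP.comp hg)) (nmul (compN.comp hf) (compN.comp hg))
  · exact nadd (nmul (compP.comp hf) (compN.comp hg)) (nmul (compN.comp hf) (compP.comp hg))
  · exact nmul (compD.comp hf) (compD.comp hg)
  · have h1 : (D (f a) : ℚ) ≠ 0 := by exact_mod_cast (D_pos _).ne'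
    have h2 : (D (g a) : ℚ) ≠ 0 := by exact_mod_cast (D_pos _).ne'
    conv_lhs => rw [eq_PND (f a), eq_PND (g a)]
    push_cast
    field_simp
    ring

theorem neg {f : A → ℚ} (hf : Computable f) : Computable (fun a => - f a) :=
  (mul (Computable.const (-1)) hf).of_eq (fun a => by ring)
theorem sub {f g : A → ℚ} (hf : Computable f) (hg : Computable g) : Computable (fun a => f a - g a) :=
  (add hf (neg hg)).of_eq (fun a => by ring)

theorem ltd {f g : A → ℚ} (hf : Computable f) (hg : Computable g) : Computable (fun a => decide (f a < g a)) := by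
  have := nltd (nadd (nmul (compP.comp hf) (compD.comp hg)) (nmul (compN.comp hg) (compD.comp hf)))
    (nadd (nmul (compP.comp hg) (compD.comp hf)) (nmul (compN.comp hf) (compD.comp hg)))
  refine this.of_eq (fun a => ?_)
  rw [decide_eq_decide]
  have h1 : (0 : ℚ) < (D (f a) : ℚ) := by exact_mod_cast (D_pos _)
  have h2 : (0 : ℚ) < (D (g a) : ℚ) := by exact_mod_cast (D_pos _)
  conv_rhs => rw [eq_PND (f a), eq_PND (g a), div_lt_div_iff₀ h1 h2]
  constructor
  · intro h
    have h : (P (f a) * D (g a) + N (g a) * D (f a) : ℚ) < P (g a) * D (f a) + N (f a) * D (g a) := by exact_mod_cast h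
    linarith
  · intro h
    have h : (P (f a) * D (g a) + N (g a) * D (f a) : ℚ) < P (g a) * D (f a) + N (f a) * D (g a) := by linarith
    exact_mod_cast h

theorem ite {B : Type*} [Primcodable B] {c : A → Prop} [DecidablePred c] {f g : A → B} (hc : Computable (fun a => decide (c a)))
    (hf : Computable f) (hg : Computable g) : Computable (fun a => if c a then f a else g a) :=
  (Computable.cond hc hf hg).of_eq (fun a => by by_cases h : c a <;> simp [h])

theorem max {f g : A → ℚ} (hf : Computable f) (hg : Computable g) : Computable (fun a => max (f a) (g a)) := by
  refine (ite (ltd hf hg) hg hf).of_eq (fun a => ?_)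
  split_ifs with h
  · exact (max_eq_right h.le).symm
  · exact (max_eq_left (not_lt.1 h)).symm

theorem half_pow {f : A → ℕ} (hf : Computable f) : Computable (fun a => (2⁻¹ : ℚ) ^ f a) := by
  have h : Computable (fun n : ℕ => (2⁻¹ : ℚ) ^ n) := by
    have := Computable.nat_rec (f := fun n : ℕ => n) (g := fun _ => (1 : ℚ)) (h := fun _ (x : ℕ × ℚ) => x.2 * 2⁻¹)
      Computable.id (Computable.const 1) (mul (Computable.snd.comp Computable.snd) (Computable.const _))
    refine this.of_eq (fun n => ?_)
    induction n with
    | zero => simp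
    | succ n ih => rw [pow_succ, ← ih]
  exact h.comp hf

end RatComp

open RatComp

theorem leftCE_of_mono {f : ℕ → ℚ} (hf : Computable f) (hm : Monotone f) {α : ℝ}
    (ht : Tendsto (fun n => (f n : ℝ)) atTop (nhds α)) : LeftCE α := by
  refine ⟨fun n => f n - 2⁻¹ ^ n, RatComp.sub hf (half_pow Computable.id), ?_, ?_⟩
  · refine strictMono_nat_of_lt_succ (fun n => ?_)
    have h1 := hm (Nat.le_succ n)
    have h2 : (2⁻¹ : ℚ) ^ (n + 1) < 2⁻¹ ^ n := pow_lt_pow_right_of_lt_one₀ (by norm_num) (by norm_num) (Nat.lt_succ_self n)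
    simp only [Nat.succ_eq_add_one] at h1
    linarith
  · have h0 : Tendsto (fun n : ℕ => (2⁻¹ : ℝ) ^ n) atTop (nhds 0) :=
      tendsto_pow_atTop_nhds_zero_of_lt_one (by norm_num) (by norm_num)
    have := ht.sub h0
    simp only [sub_zero] at this
    refine this.congr (fun n => ?_)
    push_cast
    rfl

theorem LeftCE.add {x y : ℝ} (hx : LeftCE x) (hy : LeftCE y) : LeftCE (x + y) := by
  obtain ⟨f, f1, f2, f3⟩ := hx
  obtain ⟨g, g1, g2, g3⟩ := hy
  refine leftCE_of_mono (RatComp.add f1 g1) (f2.monotone.add g2.monotone) ?_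
  refine (f3.add g3).congr (fun n => ?_)
  push_cast
  rfl

theorem LeftCE.smul {x : ℝ} (hx : LeftCE x) {q : ℚ} (hq : 0 ≤ q) : LeftCE (q * x) := by
  obtain ⟨f, f1, f2, f3⟩ := hx
  refine leftCE_of_mono (RatComp.mul (Computable.const q) f1) (f2.monotone.const_mul hq) ?_
  refine (f3.const_mul (q : ℝ)).congr (fun n => ?_)
  push_cast
  rfl

theorem RightCE.neg {x : ℝ} (hx : RightCE x) : LeftCE (-x) := by
  obtain ⟨f, f1, f2, f3⟩ := hx
  refine leftCE_of_mono (RatComp.neg f1) (f2.antitone.neg) ?_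
  refine f3.neg.congr (fun n => ?_)
  push_cast
  rfl

theorem comp_rec {A σ : Type*} [Primcodable A] [Primcodable σ] {f : A → ℕ} {g : A → σ} {F : A → ℕ → σ → σ}
    {R : A → σ} (hf : Computable f) (hg : Computable g) (hF : Computable (fun y : A × (ℕ × σ) => F y.1 y.2.1 y.2.2))
    (hR : ∀ a, R a = Nat.rec (g a) (fun n x => F a n x) (f a)) : Computable R := by
  have h2 : Computable₂ (fun (a : A) (x : ℕ × σ) => F a x.1 x.2) := hF
  have := Computable.nat_rec hf hg h2
  exact this.of_eq (fun a => (hR a).symm)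

theorem comp_opt {A σ : Type*} [Primcodable A] [Primcodable σ] {o : A → Option ℕ} {f : A → σ} {g : A → ℕ → σ}
    {R : A → σ} (ho : Computable o) (hf : Computable f) (hg : Computable (fun y : A × ℕ => g y.1 y.2))
    (hR : ∀ a, R a = Option.casesOn (o a) (f a) (g a)) : Computable R := by
  have h2 : Computable₂ g := hg
  have := Computable.option_casesOn ho hf h2
  exact this.of_eq (fun a => (hR a).symm)

def vE (e s : ℕ) : Option ℕ :=
  Nat.Partrec.Code.evaln s.unpair.2 (Denumerable.ofNat Nat.Partrec.Code e.unpair.1) s.unpair.1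

theorem comp_vE : Computable (fun y : ℕ × ℕ => vE y.1 y.2) := by
  have h : Primrec (fun y : ℕ × ℕ => ((y.2.unpair.2, Denumerable.ofNat Nat.Partrec.Code y.1.unpair.1), y.2.unpair.1)) := by
    refine (Primrec.pair (Primrec.pair ?_ ?_) ?_)
    · exact Primrec.snd.comp (Primrec.unpair.comp Primrec.snd)
    · exact (Primrec.ofNat _).comp (Primrec.fst.comp (Primrec.unpair.comp Primrec.fst))
    · exact Primrec.fst.comp (Primrec.unpair.comp Primrec.snd)
  have := Nat.Partrec.Code.primrec_evaln.comp h
  exact this.to_comp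

def stpE (e s : ℕ) (q : ℚ) : ℚ :=
  Option.casesOn (vE e s) q (fun n => Max.max q (Denumerable.ofNat ℚ n))

theorem comp_stpE : Computable (fun y : (ℕ × ℕ) × (ℕ × ℚ) => stpE y.1.1 y.2.1 y.2.2) := by
  have h1 : Computable (fun y : (ℕ × ℕ) × (ℕ × ℚ) => (y.1.1, y.2.1)) :=
    Computable.pair (Computable.fst.comp Computable.fst) (Computable.fst.comp Computable.snd)
  have h2 : Computable (fun y : (ℕ × ℕ) × (ℕ × ℚ) => y.2.2) := Computable.snd.comp Computable.snd
  have h3 : Computable (fun y : ((ℕ × ℕ) × (ℕ × ℚ)) × ℕ => Max.max y.1.2.2 (Denumerable.ofNat ℚ y.2)) :=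
    RatComp.max (h2.comp Computable.fst) ((Computable.ofNat ℚ).comp Computable.snd)
  have h4 : Computable (fun y : (ℕ × ℕ) × (ℕ × ℚ) => vE y.1.1 y.2.1) := (comp_vE.comp h1).of_eq (fun _ => rfl)
  refine comp_opt (o := fun y : (ℕ × ℕ) × (ℕ × ℚ) => vE y.1.1 y.2.1) (f := fun y => y.2.2)
    (g := fun (y : (ℕ × ℕ) × (ℕ × ℚ)) n => Max.max y.2.2 (Denumerable.ofNat ℚ n)) h4 h2 h3 ?_
  intro y
  rw [stpE]

def GE (e s : ℕ) : ℚ := Nat.rec (Denumerable.ofNat ℚ e.unpair.2) (fun s q => stpE e s q) s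

theorem comp_GE : Computable₂ GE := by
  have h1 : Computable (fun p : ℕ × ℕ => Denumerable.ofNat ℚ p.1.unpair.2) :=
    (Computable.ofNat ℚ).comp (Computable.snd.comp (Computable.unpair.comp Computable.fst))
  have : Computable (fun p : ℕ × ℕ => GE p.1 p.2) :=
    comp_rec (F := fun (p : ℕ × ℕ) n q => stpE p.1 n q) Computable.snd h1 comp_stpE (fun _ => rfl)
  exact this

/-- a uniform enumeration of the left-c.e. reals -/
theorem exists_enum : ∃ G : ℕ → ℕ → ℚ, Computable₂ G ∧ (∀ e, Monotone (G e)) ∧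
    ∀ γ, LeftCE γ → ∃ e, Tendsto (fun n => (G e n : ℝ)) atTop (nhds γ) := by
  have hGs : ∀ e s, GE e (s + 1) = stpE e s (GE e s) := fun e s => rfl
  have hG0 : ∀ e, GE e 0 = Denumerable.ofNat ℚ e.unpair.2 := fun e => rfl
  have hmono : ∀ e, Monotone (GE e) := by
    intro e
    refine monotone_nat_of_le_succ (fun s => ?_)
    rw [hGs]
    simp only [stpE]
    cases vE e s with
    | none => exact le_rfl
    | some n => exact le_max_left _ _
  refine ⟨GE, comp_GE, hmono, ?_⟩
  · rintro γ ⟨f, f1, f2, f3⟩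
    have hle : ∀ m, (f m : ℝ) ≤ γ := by
      intro m
      have hm : Monotone (fun n => (f n : ℝ)) := fun a b h => by
        have := f2.monotone h
        simpa using this
      exact hm.ge_of_tendsto f3 m
    have hp : Nat.Partrec (fun n => (Part.some (@Encodable.encode ℚ Primcodable.toEncodable (f n)) : Part ℕ)) :=
      Partrec.nat_iff.1 ((Computable.encode.comp f1).partrec)
    obtain ⟨cc, hcc⟩ := Nat.Partrec.Code.exists_code.1 hp
    let e := Nat.pair (Encodable.encode cc) (@Encodable.encode ℚ Primcodable.toEncodable (f 0))
    have he1 : Denumerable.ofNat Nat.Partrec.Code e.unpair.1 = cc := by simp [e]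
    have he2 : Denumerable.ofNat ℚ e.unpair.2 = f 0 := by
      simp only [e, Nat.unpair_pair]
      exact Denumerable.ofNat_encode (f 0)
    have hval : ∀ s n, vE e s = some n → Denumerable.ofNat ℚ n = f s.unpair.1 := by
      intro s n h
      simp only [vE, he1] at h
      have := Nat.Partrec.Code.evaln_sound h
      rw [hcc] at this
      rw [Part.mem_some_iff.1 this]
      exact Denumerable.ofNat_encode (f _)
    have hup : ∀ s, (GE e s : ℝ) ≤ γ := by
      intro s
      induction s with
      | zero => rw [hG0, he2]; exact hle 0
      | succ s ih =>
        rw [hGs]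
        simp only [stpE]
        cases h : vE e s with
        | none => exact ih
        | some n =>
          simp only [hval s n h]
          push_cast
          exact max_le ih (hle _)
    have hlow : ∀ m, ∃ s, f m ≤ GE e s := by
      intro m
      have : @Encodable.encode ℚ Primcodable.toEncodable (f m) ∈ Nat.Partrec.Code.eval cc m := by
        rw [hcc]; exact Part.mem_some _
      obtain ⟨k, hk⟩ := Nat.Partrec.Code.evaln_complete.1 this
      refine ⟨Nat.pair m k + 1, ?_⟩
      have h : vE e (Nat.pair m k) = some (@Encodable.encode ℚ Primcodable.toEncodable (f m)) := by
        simp only [vE, he1, Nat.unpair_pair]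
        exact hk
      rw [hGs]
      simp only [stpE, h]
      refine le_max_of_le_right ?_
      exact (Denumerable.ofNat_encode (f m)).symm.le
    refine ⟨e, tendsto_order.2 ⟨fun a ha => ?_, fun a ha => ?_⟩⟩
    · obtain ⟨m, hm⟩ := ((tendsto_order.1 f3).1 a ha).exists
      obtain ⟨s, hs⟩ := hlow m
      filter_upwards [eventually_ge_atTop s] with t ht
      have h1 : (f m : ℝ) ≤ GE e t := by exact_mod_cast hs.trans (hmono e ht)
      linarith
    · exact Eventually.of_forall (fun s => (hup s).trans_lt ha)

/-! ### The engine of the constructions -/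

/-- the requirement treated at stage `s` -/
def Jq (s : ℕ) : ℕ := s.unpair.1

theorem Jq_le (s : ℕ) : Jq s ≤ s := Nat.unpair_left_le s

theorem Jq_inf (j n : ℕ) : ∃ s, n ≤ s ∧ Jq s = j :=
  ⟨Nat.pair j n, Nat.right_le_pair j n, by simp [Jq]⟩

def cnt (h : List ℕ) (j : ℕ) : ℕ := (h.filter (fun a => a = j)).length
def ltc (h : List ℕ) (j : ℕ) : ℕ := (h.filter (fun a => a < j)).length

theorem comp_cnt : Computable₂ cnt :=
  (Primrec.list_length.comp (PrimrecRel.listFilter (R := fun a j : ℕ => a = j) Primrec.eq)).to_comp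
theorem comp_ltc : Computable₂ ltc :=
  (Primrec.list_length.comp (PrimrecRel.listFilter (R := fun a j : ℕ => a < j) Primrec.nat_lt)).to_comp

abbrev St := (ℚ × ℚ) × List ℕ

def stepE (dx dy : ℕ → List ℕ → ℚ) (cond : ℕ → St → Bool) (s : ℕ) (p : St) : St :=
  bif cond s p then ((p.1.1 + dx (Jq s) p.2, p.1.2 + dy (Jq s) p.2), Jq s :: p.2) else p

def stE (dx dy : ℕ → List ℕ → ℚ) (cond : ℕ → St → Bool) (n : ℕ) : St :=
  Nat.rec ((0, 0), []) (fun s p => stepE dx dy cond s p) n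

theorem comp_stE {dx dy : ℕ → List ℕ → ℚ} {cond : ℕ → St → Bool} (hx : Computable₂ dx) (hy : Computable₂ dy)
    (hc : Computable₂ cond) : Computable (stE dx dy cond) := by
  have hst : Computable (fun (y : ℕ × (ℕ × St)) => stepE dx dy cond y.2.1 y.2.2) := by
    have h1 : Computable (fun y : ℕ × (ℕ × St) => y.2.1) := Computable.fst.comp Computable.snd
    have h2 : Computable (fun y : ℕ × (ℕ × St) => y.2.2) := Computable.snd.comp Computable.snd
    have hJ : Computable (fun y : ℕ × (ℕ × St) => Jq y.2.1) := Computable.fst.comp (Computable.unpair.comp h1)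
    have hh : Computable (fun y : ℕ × (ℕ × St) => y.2.2.2) := Computable.snd.comp h2
    have a1 := RatComp.add (Computable.fst.comp (Computable.fst.comp h2)) (hx.comp hJ hh)
    have a2 := RatComp.add (Computable.snd.comp (Computable.fst.comp h2)) (hy.comp hJ hh)
    have a3 := Computable.list_cons.comp hJ hh
    have a4 := Computable.cond (hc.comp h1 h2) (Computable.pair (Computable.pair a1 a2) a3) h2
    exact a4.of_eq (fun _ => rfl)
  exact comp_rec (f := fun n : ℕ => n) (g := fun _ => (((0, 0), []) : St)) (F := fun _ n x => stepE dx dy cond n x)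
    Computable.id (Computable.const _) hst (fun _ => rfl)

structure Hist (c l : ℕ → ℕ → ℕ) (act : ℕ → Prop) : Prop where
  c0 : ∀ j, c j 0 = 0
  l0 : ∀ j, l j 0 = 0
  cs : ∀ j s, act s → Jq s = j → c j (s + 1) = c j s + 1
  cn : ∀ j s, ¬ (act s ∧ Jq s = j) → c j (s + 1) = c j s
  ls : ∀ j s, act s → Jq s < j → l j (s + 1) = l j s + 1
  ln : ∀ j s, ¬ (act s ∧ Jq s < j) → l j (s + 1) = l j s

theorem hist_stE (dx dy : ℕ → List ℕ → ℚ) (cond : ℕ → St → Bool) :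
    Hist (fun j s => cnt (stE dx dy cond s).2 j) (fun j s => ltc (stE dx dy cond s).2 j)
      (fun s => cond s (stE dx dy cond s) = true) where
  c0 j := rfl
  l0 j := rfl
  cs j s h1 h2 := by
    change cnt (stepE dx dy cond s (stE dx dy cond s)).2 j = _
    simp [stepE, h1, cnt, h2]
  cn j s h := by
    change cnt (stepE dx dy cond s (stE dx dy cond s)).2 j = _
    by_cases h1 : cond s (stE dx dy cond s) = true
    · have h2 : ¬ Jq s = j := fun h2 => h ⟨h1, h2⟩
      simp [stepE, h1, cnt, h2]
    · simp [stepE, h1]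
  ls j s h1 h2 := by
    change ltc (stepE dx dy cond s (stE dx dy cond s)).2 j = _
    simp [stepE, h1, ltc, h2]
  ln j s h := by
    change ltc (stepE dx dy cond s (stE dx dy cond s)).2 j = _
    by_cases h1 : cond s (stE dx dy cond s) = true
    · have h2 : ¬ Jq s < j := fun h2 => h ⟨h1, h2⟩
      simp [stepE, h1, ltc, not_lt.1 h2]
    · simp [stepE, h1]

namespace Hist
variable {c l : ℕ → ℕ → ℕ} {act : ℕ → Prop}

theorem c_mono (H : Hist c l act) (j : ℕ) : Monotone (c j) := by
  refine monotone_nat_of_le_succ (fun s => ?_)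
  by_cases h : act s ∧ Jq s = j
  · rw [H.cs j s h.1 h.2]; omega
  · rw [H.cn j s h]

theorem l_mono (H : Hist c l act) (j : ℕ) : Monotone (l j) := by
  refine monotone_nat_of_le_succ (fun s => ?_)
  by_cases h : act s ∧ Jq s < j
  · rw [H.ls j s h.1 h.2]; omega
  · rw [H.ln j s h]

theorem l_succ (H : Hist c l act) (j s : ℕ) : l (j + 1) s = l j s + c j s := by
  induction s with
  | zero => rw [H.l0, H.l0, H.c0]
  | succ s ih =>
    by_cases h : act s
    · rcases lt_trichotomy (Jq s) j with h1 | h1 | h1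
      · rw [H.ls (j+1) s h (by omega), H.ls j s h h1, H.cn j s (by omega)]; omega
      · rw [H.ls (j+1) s h (by omega), H.ln j s (by omega), H.cs j s h h1]; omega
      · rw [H.ln (j+1) s (by omega), H.ln j s (by omega), H.cn j s (by omega)]; omega
    · rw [H.ln (j+1) s (by tauto), H.ln j s (by tauto), H.cn j s (by tauto)]; omega

theorem l_zero (H : Hist c l act) (s : ℕ) : l 0 s = 0 := by
  induction s with
  | zero => exact H.l0 0
  | succ s ih => rw [H.ln 0 s (by simp), ih]

theorem l_le (H : Hist c l act) {i j : ℕ} (h : i ≤ j) (s : ℕ) : l i s ≤ l j s := by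
  induction j, h using Nat.le_induction with
  | base => exact le_rfl
  | succ j _ ih => rw [H.l_succ]; omega

theorem c_le_l (H : Hist c l act) {i j : ℕ} (h : i < j) (s : ℕ) : c i s ≤ l j s := by
  have := H.l_le (Nat.succ_le_of_lt h) s
  rw [Nat.succ_eq_add_one, H.l_succ] at this
  omega

theorem sum_step (H : Hist c l act) (v : ℕ → ℕ → ℚ) {M s : ℕ} (hs : s < M) (ha : act s) :
    ∑ k ∈ Finset.range M, v k (c k (s + 1)) = ∑ k ∈ Finset.range M, v k (c k s)
      + (v (Jq s) (c (Jq s) s + 1) - v (Jq s) (c (Jq s) s)) := by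
  rw [← sub_eq_iff_eq_add', ← Finset.sum_sub_distrib, Finset.sum_eq_single (Jq s)]
  · rw [H.cs _ s ha rfl]
  · intro b _ hb
    rw [H.cn b s (fun h => hb h.2.symm), sub_self]
  · intro h
    exact absurd (Finset.mem_range.2 ((Jq_le s).trans_lt hs)) h

theorem sum_step' (H : Hist c l act) (v : ℕ → ℕ → ℚ) {M s : ℕ} (ha : ¬ act s) :
    ∑ k ∈ Finset.range M, v k (c k (s + 1)) = ∑ k ∈ Finset.range M, v k (c k s) := by
  refine Finset.sum_congr rfl (fun k _ => ?_)
  rw [H.cn k s (fun h => ha h.1)]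

/-- if `c j` is bounded then visits eventually do not act -/
theorem no_act (H : Hist c l act) {j B : ℕ} (hB : ∀ s, c j s ≤ B) (n : ℕ) : ∃ m, n ≤ m ∧ Jq m = j ∧ ¬ act m := by
  by_contra hcon
  push Not at hcon
  have : ∀ k, ∃ s, n ≤ s ∧ k ≤ c j s := by
    intro k
    induction k with
    | zero => exact ⟨n, le_rfl, Nat.zero_le _⟩
    | succ k ih =>
      obtain ⟨s, hs, hk⟩ := ih
      obtain ⟨m, hm, hj⟩ := Jq_inf j s
      refine ⟨m + 1, by omega, ?_⟩
      rw [H.cs j m (hcon m (by omega) hj) hj]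
      have := H.c_mono j hm
      omega
  obtain ⟨s, _, hs⟩ := this (B + 1)
  have := hB s
  omega

/-- if `c j` is unbounded then there are late acts with large counts -/
theorem late_act (H : Hist c l act) {j : ℕ} (hB : ∀ B, ∃ s, B < c j s) (n k : ℕ) :
    ∃ t, n ≤ t ∧ k ≤ c j t ∧ act t ∧ Jq t = j := by
  by_contra hcon
  push Not at hcon
  obtain ⟨s0, hs0⟩ := hB k
  have : ∀ s, s0 + n ≤ s → c j s = c j (s0 + n) := by
    intro s hs
    induction s, hs using Nat.le_induction with
    | base => rfl
    | succ s hs ih =>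
      rw [← ih]
      refine H.cn j s (fun h => hcon s (by omega) ?_ h.1 h.2)
      exact hs0.le.trans (H.c_mono j (by omega))
  obtain ⟨s1, hs1⟩ := hB (c j (s0 + n))
  have h1 := this (max s1 (s0 + n)) (le_max_right _ _)
  have h2 := H.c_mono j (le_max_left s1 (s0 + n))
  omega

end Hist

theorem eventually_const {u : ℕ → ℕ} (hu : Monotone u) {B : ℕ} (hB : ∀ s, u s ≤ B) :
    ∃ s0, ∀ s, s0 ≤ s → u s = u s0 := by
  by_contra hcon
  push Not at hcon
  have : ∀ k, ∃ s, k ≤ u s := by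
    intro k
    induction k with
    | zero => exact ⟨0, Nat.zero_le _⟩
    | succ k ih =>
      obtain ⟨s, hs⟩ := ih
      obtain ⟨t, ht, hne⟩ := hcon s
      have := hu ht
      exact ⟨t, by omega⟩
  obtain ⟨s, hs⟩ := this (B + 1)
  have := hB s
  omega

theorem tendsto_of_close {G : ℕ → ℝ} (hG : Monotone G) {ψ : ℕ → ℝ} {x : ℝ} (hψ : Tendsto ψ atTop (nhds x))
    (h : ∀ n : ℕ, ∀ ε > 0, ∃ t, n ≤ t ∧ |ψ t - G t| < ε) : Tendsto G atTop (nhds x) := by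
  have h2 : ∀ n : ℕ, ∀ ε > 0, ∃ t, n ≤ t ∧ |G t - x| < ε := by
    intro n ε hε
    obtain ⟨N, hN⟩ := Metric.tendsto_atTop.1 hψ (ε / 2) (by linarith)
    obtain ⟨t, ht, h3⟩ := h (max n N) (ε / 2) (by linarith)
    have h4 := hN t ((le_max_right _ _).trans ht)
    rw [Real.dist_eq] at h4
    refine ⟨t, (le_max_left _ _).trans ht, ?_⟩
    rw [abs_lt] at *
    constructor <;> linarith [h3.1, h3.2, h4.1, h4.2]
  rw [Metric.tendsto_atTop]
  intro ε hε
  obtain ⟨t, _, ht⟩ := h2 0 ε hε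
  refine ⟨t, fun s hs => ?_⟩
  obtain ⟨r, hr, hr2⟩ := h2 s ε hε
  rw [Real.dist_eq]
  rw [abs_lt] at *
  have h5 := hG hs
  have h6 := hG hr
  constructor <;> linarith [ht.1, ht.2, hr2.1, hr2.2]

theorem sum_half_le (M : ℕ) : ∑ k ∈ Finset.range M, (2⁻¹ : ℚ) ^ k ≤ 2 := by
  have : ∀ M : ℕ, ∑ k ∈ Finset.range M, (2⁻¹ : ℚ) ^ k = 2 - 2 * 2⁻¹ ^ M := by
    intro M
    induction M with
    | zero => simp
    | succ M ih => rw [Finset.sum_range_succ, ih, pow_succ]; ring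
  rw [this]
  have : (0 : ℚ) < 2⁻¹ ^ M := by positivity
  linarith

theorem exists_lim {f : ℕ → ℚ} (hf : Monotone f) {B : ℚ} (hB : ∀ n, f n ≤ B) :
    ∃ x : ℝ, Tendsto (fun n => (f n : ℝ)) atTop (nhds x) := by
  have hm : Monotone (fun n => (f n : ℝ)) := fun a b h => by
    have := hf h
    simpa using this
  refine ⟨_, tendsto_atTop_ciSup hm ⟨(B : ℝ), ?_⟩⟩
  rintro _ ⟨n, rfl⟩
  have := hB n
  simpa using this

theorem stE_act {dx dy : ℕ → List ℕ → ℚ} {cond : ℕ → St → Bool} {s : ℕ}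
    (h : cond s (stE dx dy cond s) = true) : stE dx dy cond (s + 1) =
      (((stE dx dy cond s).1.1 + dx (Jq s) (stE dx dy cond s).2,
        (stE dx dy cond s).1.2 + dy (Jq s) (stE dx dy cond s).2), Jq s :: (stE dx dy cond s).2) := by
  change stepE dx dy cond s (stE dx dy cond s) = _
  rw [stepE, h, cond_true]

theorem stE_nact {dx dy : ℕ → List ℕ → ℚ} {cond : ℕ → St → Bool} {s : ℕ}
    (h : ¬ cond s (stE dx dy cond s) = true) : stE dx dy cond (s + 1) = stE dx dy cond s := by
  change stepE dx dy cond s (stE dx dy cond s) = _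
  rw [Bool.not_eq_true] at h
  rw [stepE, h, cond_false]

/-! ### The second engine -/

def aj (j : ℕ) : ℚ := 2⁻¹ ^ (j * j + 4 * j)

theorem aj_pos (j : ℕ) : 0 < aj j := by unfold aj; positivity

theorem aj_small {j k : ℕ} (h : j < k) : 2 ^ k * aj k ≤ aj j / 8 * 2⁻¹ ^ k := by
  have h1 : (2 : ℚ) ^ k * 2⁻¹ ^ k = 1 := by rw [← mul_pow]; norm_num
  have h2 : aj k ≤ 2⁻¹ ^ (j * j + 4 * j + 3 + k + k) := by
    unfold aj
    refine pow_le_pow_of_le_one (by norm_num) (by norm_num) ?_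
    nlinarith
  calc 2 ^ k * aj k ≤ 2 ^ k * 2⁻¹ ^ (j * j + 4 * j + 3 + k + k) := by gcongr
    _ = (2 ^ k * 2⁻¹ ^ k) * (2⁻¹ ^ (j * j + 4 * j) * 2⁻¹ ^ 3 * 2⁻¹ ^ k) := by ring
    _ = aj j / 8 * 2⁻¹ ^ k := by rw [h1, aj]; ring

theorem aj_small' (k : ℕ) : 2 ^ k * aj k ≤ 2⁻¹ ^ k := by
  have h1 : (2 : ℚ) ^ k * 2⁻¹ ^ k = 1 := by rw [← mul_pow]; norm_num
  have h2 : aj k ≤ 2⁻¹ ^ (k + k) := by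
    unfold aj
    refine pow_le_pow_of_le_one (by norm_num) (by norm_num) ?_
    nlinarith
  calc 2 ^ k * aj k ≤ 2 ^ k * 2⁻¹ ^ (k + k) := by gcongr
    _ = (2 ^ k * 2⁻¹ ^ k) * (2⁻¹ ^ k) := by ring
    _ = 2⁻¹ ^ k := by rw [h1]; ring

theorem Hist.c_le_pow {c l : ℕ → ℕ → ℕ} {act : ℕ → Prop} (H : Hist c l act) {s : ℕ}
    (h : ∀ j, c j s ≤ l j s + 1) (j : ℕ) : c j s ≤ 2 ^ j := by
  have : ∀ j, l j s + 1 ≤ 2 ^ j := by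
    intro j
    induction j with
    | zero => rw [H.l_zero]; simp
    | succ j ih => rw [H.l_succ, pow_succ]; have := h j; omega
  exact (h j).trans (this j)

theorem Hist.engine2 {c l : ℕ → ℕ → ℕ} {act : ℕ → Prop} (H : Hist c l act) {E g : ℕ → ℕ → ℚ}
    (hg : ∀ j, Monotone (g j))
    (h1 : ∀ s, act s → E (Jq s) (s + 1) = E (Jq s) s - aj (Jq s))
    (h2 : ∀ s j, act s → E j (s + 1) ≤ E j s + aj (Jq s))
    (h3 : ∀ s j, ¬ act s → E j (s + 1) = E j s)
    (h4 : ∀ s, act s → |E (Jq s) s - g (Jq s) s| < aj (Jq s) / 4) (s j : ℕ) : c j s ≤ 2 ^ j := by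
  let v : ℕ → ℕ → ℕ → ℚ := fun j k n => if j < k then n * aj k else 0
  have hv0 : ∀ j k n, 0 ≤ v j k n := by
    intro j k n
    simp only [v]
    have := aj_pos k
    split_ifs <;> positivity
  have main : ∀ M s, s ≤ M → ∀ j, c j s ≤ l j s ∨ (c j s = l j s + 1 ∧
      E j s - ∑ k ∈ Finset.range M, v j k (c k s) + aj j / 2 ≤ g j s) := by
    intro M s
    induction s with
    | zero => intro _ j; left; rw [H.c0]; exact Nat.zero_le _
    | succ s ih =>
      intro hs
      have ih := ih (by omega)
      intro j
      by_cases ha : act s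
      · have hst := H.sum_step (v j) (M := M) (by omega) ha
        rcases lt_trichotomy (Jq s) j with h | h | h
        · left
          rw [H.ls j s ha h, H.cn j s (by omega)]
          rcases ih j with h' | h' <;> omega
        · have hS : ∑ k ∈ Finset.range M, v j k (c k s) ≤ aj j / 4 := by
            have : ∀ k ∈ Finset.range M, v j k (c k s) ≤ aj j / 8 * 2⁻¹ ^ k := by
              intro k _
              simp only [v]
              split_ifs with hjk
              · refine le_trans ?_ (aj_small hjk)
                have h5 : c k s ≤ 2 ^ k := H.c_le_pow (fun j => by rcases ih j with h' | h' <;> omega) k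
                have h6 : (c k s : ℚ) ≤ 2 ^ k := by exact_mod_cast h5
                have := aj_pos k
                gcongr
              · have := aj_pos j
                positivity
            refine (Finset.sum_le_sum this).trans ?_
            rw [← Finset.mul_sum]
            have h5 := sum_half_le M
            have := aj_pos j
            nlinarith
          have hS0 : 0 ≤ ∑ k ∈ Finset.range M, v j k (c k (s + 1)) := Finset.sum_nonneg (fun k _ => hv0 _ _ _)
          have h4' := h4 s ha
          have h1' := h1 s ha
          rw [h] at h4' h1'
          rw [abs_lt] at h4'
          have hgm := hg j (Nat.le_succ s)
          rw [Nat.succ_eq_add_one] at hgm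
          rw [H.cs j s ha h, H.ln j s (by omega), h1']
          have hp := aj_pos j
          rcases ih j with h' | ⟨_, h'⟩
          · rcases h'.lt_or_eq with h' | h'
            · left; omega
            · right
              refine ⟨by omega, ?_⟩
              linarith [h4'.1]
          · exfalso
            linarith [h4'.2, h4'.1]
        · rw [H.ln j s (by omega), H.cn j s (by omega)]
          rcases ih j with h' | ⟨h0, h'⟩
          · left; exact h'
          · right
            refine ⟨h0, ?_⟩
            rw [hst]
            simp only [v, if_pos h]
            have := h2 s j ha
            have hgm := hg j (Nat.le_succ s)
            rw [Nat.succ_eq_add_one] at hgm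
            simp only [v] at h'
            push_cast
            linarith
      · rw [H.ln j s (by tauto), H.cn j s (by tauto), H.sum_step' (v j) ha, h3 s j ha]
        have hgm := hg j (Nat.le_succ s)
        exact (ih j).imp_right (fun h => ⟨h.1, h.2.trans hgm⟩)
  exact H.c_le_pow (fun j => by rcases main s s le_rfl j with h' | h' <;> omega) j

def dx2 (j : ℕ) (_ : List ℕ) : ℚ := if j % 2 = 0 then 0 else aj j
def dy2 (j : ℕ) (_ : List ℕ) : ℚ := if j % 2 = 0 then aj j else 0
def E2 (j : ℕ) (x y : ℚ) : ℚ := if j % 2 = 0 then x - y else y - x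

def cond2 (G : ℕ → ℕ → ℚ) (s : ℕ) (p : St) : Bool :=
  (decide (E2 (Jq s) p.1.1 p.1.2 - G (Jq s / 2) s < aj (Jq s) * 4⁻¹)) &&
    decide (G (Jq s / 2) s - E2 (Jq s) p.1.1 p.1.2 < aj (Jq s) * 4⁻¹)

theorem comp_aj : Computable aj :=
  half_pow (RatComp.nadd (RatComp.nmul Computable.id Computable.id) (RatComp.nmul (Computable.const 4) Computable.id))

theorem comp_even {A : Type*} [Primcodable A] {f : A → ℕ} (hf : Computable f) :
    Computable (fun a => decide (f a % 2 = 0)) :=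
  RatComp.neqd (Primrec.nat_mod.to_comp.comp hf (Computable.const 2)) (Computable.const 0)

theorem comp_half {A : Type*} [Primcodable A] {f : A → ℕ} (hf : Computable f) :
    Computable (fun a => f a / 2) :=
  Primrec.nat_div.to_comp.comp hf (Computable.const 2)

theorem comp_dx2 : Computable₂ dx2 := by
  have : Computable (fun y : ℕ × List ℕ => if y.1 % 2 = 0 then 0 else aj y.1) :=
    RatComp.ite (comp_even Computable.fst) (Computable.const 0) (comp_aj.comp Computable.fst)
  exact this

theorem comp_dy2 : Computable₂ dy2 := by
  have : Computable (fun y : ℕ × List ℕ => if y.1 % 2 = 0 then aj y.1 else 0) :=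
    RatComp.ite (comp_even Computable.fst) (comp_aj.comp Computable.fst) (Computable.const 0)
  exact this

theorem comp_Jq : Computable Jq := Computable.fst.comp Computable.unpair

theorem comp_cond2 {G : ℕ → ℕ → ℚ} (hG : Computable₂ G) : Computable₂ (cond2 G) := by
  have hJ : Computable (fun y : ℕ × St => Jq y.1) := comp_Jq.comp Computable.fst
  have hx : Computable (fun y : ℕ × St => y.2.1.1) := Computable.fst.comp (Computable.fst.comp Computable.snd)
  have hy : Computable (fun y : ℕ × St => y.2.1.2) := Computable.snd.comp (Computable.fst.comp Computable.snd)
  have hE : Computable (fun y : ℕ × St => E2 (Jq y.1) y.2.1.1 y.2.1.2) :=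
    RatComp.ite (comp_even hJ) (RatComp.sub hx hy) (RatComp.sub hy hx)
  have hg : Computable (fun y : ℕ × St => G (Jq y.1 / 2) y.1) := hG.comp (comp_half hJ) Computable.fst
  have ha : Computable (fun y : ℕ × St => aj (Jq y.1) * 4⁻¹) :=
    RatComp.mul (comp_aj.comp hJ) (Computable.const _)
  have := Primrec.and.to_comp.comp (RatComp.ltd (RatComp.sub hE hg) ha) (RatComp.ltd (RatComp.sub hg hE) ha)
  exact this.of_eq (fun _ => rfl)

theorem lemma2 : ∃ δ β : ℝ, LeftCE δ ∧ LeftCE β ∧ ¬ LeftCE (δ - β) ∧ ¬ LeftCE (β - δ) := by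
  obtain ⟨G, hG, hGm, hGe⟩ := exists_enum
  have hcomp := comp_stE comp_dx2 comp_dy2 (comp_cond2 hG)
  have H := hist_stE dx2 dy2 (cond2 G)
  have hact := fun s => stE_act (dx := dx2) (dy := dy2) (cond := cond2 G) (s := s)
  have hnact := fun s => stE_nact (dx := dx2) (dy := dy2) (cond := cond2 G) (s := s)
  have h00 : (stE dx2 dy2 (cond2 G) 0) = ((0, 0), []) := rfl
  generalize stE dx2 dy2 (cond2 G) = st at hcomp H hact hnact h00
  have hX : Computable (fun s => (st s).1.1) := Computable.fst.comp (Computable.fst.comp hcomp)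
  have hY : Computable (fun s => (st s).1.2) := Computable.snd.comp (Computable.fst.comp hcomp)
  have hc2 : ∀ s, cond2 G s (st s) = true ↔
      |E2 (Jq s) (st s).1.1 (st s).1.2 - G (Jq s / 2) s| < aj (Jq s) / 4 := by
    intro s
    simp only [cond2, Bool.and_eq_true, decide_eq_true_eq, abs_lt]
    constructor
    · rintro ⟨h1, h2⟩; constructor <;> linarith
    · rintro ⟨h1, h2⟩; constructor <;> linarith
  have hbd := H.engine2 (E := fun j s => E2 j (st s).1.1 (st s).1.2) (g := fun j s => G (j / 2) s)
    (fun j => hGm _)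
    (fun s ha => by
      rw [hact s ha]; simp only [E2, dx2, dy2]; split_ifs <;> ring)
    (fun s j ha => by
      have := aj_pos (Jq s)
      rw [hact s ha]; simp only [E2, dx2, dy2]; split_ifs <;> linarith)
    (fun s j ha => by rw [hnact s ha])
    (fun s ha => (hc2 s).1 ha)
  have hXm : Monotone (fun s => (st s).1.1) := by
    refine monotone_nat_of_le_succ (fun s => ?_)
    by_cases ha : cond2 G s (st s) = true
    · have := aj_pos (Jq s)
      rw [hact s ha]; simp only [dx2]; split_ifs <;> linarith
    · rw [hnact s ha]
  have hYm : Monotone (fun s => (st s).1.2) := by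
    refine monotone_nat_of_le_succ (fun s => ?_)
    by_cases ha : cond2 G s (st s) = true
    · have := aj_pos (Jq s)
      rw [hact s ha]; simp only [dy2]; split_ifs <;> linarith
    · rw [hnact s ha]
  have hsum : ∀ M s, s ≤ M → (st s).1.1 + (st s).1.2 = ∑ k ∈ Finset.range M, (cnt (st s).2 k : ℚ) * aj k := by
    intro M s
    induction s with
    | zero => intro _; rw [h00]; simp [cnt]
    | succ s ih =>
      intro hs
      have ih := ih (by omega)
      by_cases ha : cond2 G s (st s) = true
      · have := H.sum_step (fun k n => (n : ℚ) * aj k) (M := M) (by omega) ha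
        rw [this, ← ih, hact s ha]
        simp only [dx2, dy2]
        push_cast
        split_ifs <;> ring
      · have := H.sum_step' (fun k n => (n : ℚ) * aj k) (M := M) ha
        rw [this, ← ih, hnact s ha]
  have hB : ∀ s, (st s).1.1 + (st s).1.2 ≤ 2 := by
    intro s
    rw [hsum s s le_rfl]
    refine le_trans (Finset.sum_le_sum (fun k _ => ?_)) (sum_half_le s)
    refine le_trans ?_ (aj_small' k)
    have h6 : ((cnt (st s).2 k : ℕ) : ℚ) ≤ 2 ^ k := by exact_mod_cast hbd s k
    have := aj_pos k
    gcongr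
  have hX0 : ∀ s, 0 ≤ (st s).1.1 := fun s => by
    have := hXm (Nat.zero_le s)
    simpa [h00] using this
  have hY0 : ∀ s, 0 ≤ (st s).1.2 := fun s => by
    have := hYm (Nat.zero_le s)
    simpa [h00] using this
  obtain ⟨δ, hδ⟩ := exists_lim hXm (B := 2) (fun s => by linarith [hB s, hY0 s])
  obtain ⟨β, hβ⟩ := exists_lim hYm (B := 2) (fun s => by linarith [hB s, hX0 s])
  have key : ∀ j, ∀ z : ℝ, Tendsto (fun s => ((E2 j (st s).1.1 (st s).1.2 : ℚ) : ℝ)) atTop (nhds z) →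
      Tendsto (fun s => (G (j / 2) s : ℝ)) atTop (nhds z) → False := by
    intro j z h1 h2
    have h3 := h1.sub h2
    rw [sub_self] at h3
    have hp : (0 : ℝ) < ((aj j / 4 : ℚ) : ℝ) := by
      have := aj_pos j
      exact_mod_cast (by positivity : (0 : ℚ) < aj j / 4)
    obtain ⟨n, hn⟩ := Metric.tendsto_atTop.1 h3 _ hp
    obtain ⟨m, hm, hj, hna⟩ := H.no_act (fun s => hbd s j) n
    apply hna
    rw [hc2 m, hj]
    have := hn m hm
    rw [Real.dist_eq, sub_zero] at this
    exact_mod_cast this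
  refine ⟨δ, β, leftCE_of_mono hX hXm hδ, leftCE_of_mono hY hYm hβ, fun h => ?_, fun h => ?_⟩
  · obtain ⟨e, he⟩ := hGe _ h
    refine key (2 * e) _ ?_ (by rw [Nat.mul_div_cancel_left _ (by norm_num)]; exact he)
    refine (hδ.sub hβ).congr (fun s => ?_)
    simp [E2]
  · obtain ⟨e, he⟩ := hGe _ h
    refine key (2 * e + 1) _ ?_ (by rw [show (2 * e + 1) / 2 = e by omega]; exact he)
    refine (hβ.sub hδ).congr (fun s => ?_)
    have : (2 * e + 1) % 2 ≠ 0 := by omega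
    simp [E2]

/-! ### The first engine -/

theorem comp_find {P : ℕ → ℕ → Bool} (hP : Computable (fun y : ℕ × ℕ => P y.1 y.2))
    (h : ∀ k, ∃ t, P k t = true) : ∃ T : ℕ → ℕ, Computable T ∧ ∀ k, P k (T k) = true := by
  have hb : Computable₂ P := hP
  refine ⟨fun k => Nat.find (h k), (Partrec.rfind hb.partrec₂).of_eq_tot (fun k => ?_), fun k => Nat.find_spec (h k)⟩
  rw [Nat.mem_rfind]
  refine ⟨?_, fun {m} hm => ?_⟩
  · simp only [PFun.coe_val, Part.mem_some_iff]
    exact (Nat.find_spec (h k)).symm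
  · simp only [PFun.coe_val, Part.mem_some_iff]
    have := Nat.find_min (h k) hm
    simpa using this

theorem Hist.bound {c l : ℕ → ℕ → ℕ} {act : ℕ → Prop} (H : Hist c l act) {W b : ℕ → ℚ} {B : ℚ}
    (hW : Monotone W) (hB : ∀ i, W i - W 0 ≤ B)
    (hbn : ∀ s, ¬ act s → b (s + 1) = b s) {n t : ℕ}
    (hba : ∀ r, t ≤ r → act r → b (r + 1) - b r ≤
      2⁻¹ ^ n * (2⁻¹ ^ Jq r * (W (c (Jq r) r + 1) - W (c (Jq r) r)))) {s : ℕ} (hs : t ≤ s) :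
    b s - b t ≤ 2⁻¹ ^ n * (2 * B) := by
  have key : ∀ M, s ≤ M → b s - b t ≤ 2⁻¹ ^ n * (∑ k ∈ Finset.range M, 2⁻¹ ^ k * W (c k s)
      - ∑ k ∈ Finset.range M, 2⁻¹ ^ k * W (c k t)) := by
    intro M
    induction s, hs using Nat.le_induction with
    | base => intro _; simp
    | succ s hs ih =>
      intro hM
      have ih := ih (by omega)
      by_cases ha : act s
      · have := H.sum_step (fun k n => 2⁻¹ ^ k * W n) (M := M) (by omega) ha
        rw [this]
        have := hba s hs ha
        linarith
      · have := H.sum_step' (fun k n => 2⁻¹ ^ k * W n) (M := M) ha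
        rw [this, hbn s ha]
        exact ih
  have hB0 : 0 ≤ B := by simpa using hB 0
  refine (key s le_rfl).trans ?_
  gcongr
  rw [← Finset.sum_sub_distrib]
  have : ∀ k ∈ Finset.range s, (2⁻¹ : ℚ) ^ k * W (c k s) - 2⁻¹ ^ k * W (c k t) ≤ 2⁻¹ ^ k * B := by
    intro k _
    rw [← mul_sub]
    gcongr
    have h1 := hB (c k s)
    have h2 := hW (Nat.zero_le (c k t))
    linarith
  refine (Finset.sum_le_sum this).trans ?_
  rw [← Finset.sum_mul]
  exact mul_le_mul_of_nonneg_right (sum_half_le s) hB0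

section
variable {c l : ℕ → ℕ → ℕ} {act : ℕ → Prop} {W b A : ℕ → ℚ} {B : ℚ} {G : ℕ → ℕ → ℚ}

/-- increments of the first construction -/
def inc1 (W : ℕ → ℚ) (j cj lj : ℕ) : ℚ :=
  if j % 2 = 0 then 0 else 2⁻¹ ^ (j + lj) * (W (cj + 1) - W cj)

def E1 (j : ℕ) (b a : ℚ) : ℚ := if j % 2 = 0 then b - a else a - b

theorem inc1_nonneg (hW : Monotone W) (j cj lj : ℕ) : 0 ≤ inc1 W j cj lj := by
  unfold inc1
  have := hW (Nat.le_succ cj)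
  rw [Nat.succ_eq_add_one] at this
  split_ifs
  · exact le_rfl
  · exact mul_nonneg (by positivity) (by linarith)

theorem inc1_le (hW : Monotone W) {j cj lj n : ℕ} (h : j % 2 ≠ 0 → n ≤ lj) :
    inc1 W j cj lj ≤ 2⁻¹ ^ n * (2⁻¹ ^ j * (W (cj + 1) - W cj)) := by
  have h0 := hW (Nat.le_succ cj)
  rw [Nat.succ_eq_add_one] at h0
  have h1 : 0 ≤ W (cj + 1) - W cj := by linarith
  unfold inc1
  split_ifs with hj
  · positivity
  · rw [← mul_assoc]
    refine mul_le_mul_of_nonneg_right ?_ h1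
    rw [← pow_add]
    exact pow_le_pow_of_le_one (by norm_num) (by norm_num) (by have := h hj; omega)

theorem Hist.no_lower (H : Hist c l act) {j s0 : ℕ} (h : ∀ s, s0 ≤ s → l j s = l j s0) {r : ℕ} (hr : s0 ≤ r)
    (ha : act r) : j ≤ Jq r := by
  by_contra hlt
  have h1 := H.ls j r ha (by omega)
  rw [h r hr, h (r + 1) (by omega)] at h1
  omega

theorem even_case (H : Hist c l act) (hW : Monotone W) (hB : ∀ i, W i - W 0 ≤ B)
    (hbn : ∀ s, ¬ act s → b (s + 1) = b s)
    (hba : ∀ s, act s → b (s + 1) = b s + inc1 W (Jq s) (c (Jq s) s) (l (Jq s) s))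
    (hG : ∀ e, Monotone (G e))
    (hact : ∀ s, act s → |E1 (Jq s) (b s) (A s) - G (Jq s / 2) s| < 2⁻¹ ^ c (Jq s) s)
    (hA : Computable A) (hAm : Monotone A) {α : ℝ} (hα : Tendsto (fun n => (A n : ℝ)) atTop (nhds α))
    {j : ℕ} (hcj : Computable (c j)) (hj : j % 2 = 0) {s0 : ℕ} (hs0 : ∀ s, s0 ≤ s → l j s = l j s0)
    (hunb : ∀ B, ∃ s, B < c j s) : ComputableReal α := by
  have hB0 : 0 ≤ B := by simpa using hB 0
  have hle : ∀ n, (A n : ℝ) ≤ α := by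
    have hm : Monotone (fun n => (A n : ℝ)) := fun a b h => by
      have := hAm h
      simpa using this
    exact fun n => hm.ge_of_tendsto hα n
  have hclose : ∀ k t, s0 ≤ t → k ≤ c j t → act t → Jq t = j → α - A t ≤ ((2 * B + 2 : ℚ) : ℝ) * 2⁻¹ ^ k := by
    intro k t ht hk ha hJ
    have h1 : ∀ n, A n - A t ≤ (2 * B + 2) * 2⁻¹ ^ k := by
      intro n
      obtain ⟨t', ht', hk', ha', hJ'⟩ := H.late_act hunb (max n t) k
      have hbb : b t' - b t ≤ 2⁻¹ ^ k * (2 * B) := by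
        refine H.bound hW hB hbn (fun r hr har => ?_) ((le_max_right _ _).trans ht')
        rw [hba r har, add_sub_cancel_left]
        refine inc1_le hW (fun hodd => ?_)
        have h2 := H.no_lower hs0 (ht.trans hr) har
        have h3 : j < Jq r := lt_of_le_of_ne h2 (fun h => hodd (h ▸ hj))
        exact (hk.trans (H.c_mono j hr)).trans (H.c_le_l h3 r)
      have e1 := hact t ha
      have e2 := hact t' ha'
      rw [hJ, E1, if_pos hj, abs_lt] at e1
      rw [hJ', E1, if_pos hj, abs_lt] at e2
      have p1 : (2⁻¹ : ℚ) ^ c j t ≤ 2⁻¹ ^ k := pow_le_pow_of_le_one (by norm_num) (by norm_num) hk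
      have p2 : (2⁻¹ : ℚ) ^ c j t' ≤ 2⁻¹ ^ k := pow_le_pow_of_le_one (by norm_num) (by norm_num) hk'
      have g1 := hG (j / 2) ((le_max_right n t).trans ht')
      have a1 := hAm ((le_max_left n t).trans ht')
      linarith [e1.1, e1.2, e2.1, e2.2]
    have h2 : ∀ n, (A n : ℝ) ≤ A t + ((2 * B + 2 : ℚ) : ℝ) * 2⁻¹ ^ k := by
      intro n
      have := h1 n
      have h3 : A n ≤ A t + (2 * B + 2) * 2⁻¹ ^ k := by linarith
      have h4 := (Rat.cast_le (K := ℝ)).2 h3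
      push_cast at h4 ⊢
      exact h4
    have := le_of_tendsto' hα h2
    linarith
  obtain ⟨T, hT, hT2⟩ := comp_find (P := fun k t => (decide (s0 < t + 1) && decide (k < c j t + 1)) &&
      decide (c j t < c j (t + 1))) (by
        have h1 : Computable (fun y : ℕ × ℕ => decide (s0 < y.2 + 1)) :=
          RatComp.nltd (Computable.const s0) (Computable.succ.comp Computable.snd)
        have h2 : Computable (fun y : ℕ × ℕ => decide (y.1 < c j y.2 + 1)) :=
          RatComp.nltd Computable.fst (Computable.succ.comp (hcj.comp Computable.snd))
        have h3 : Computable (fun y : ℕ × ℕ => decide (c j y.2 < c j (y.2 + 1))) :=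
          RatComp.nltd (hcj.comp Computable.snd) (hcj.comp (Computable.succ.comp Computable.snd))
        exact (Primrec.and.to_comp.comp (Primrec.and.to_comp.comp h1 h2) h3).of_eq (fun _ => rfl))
    (by
      intro k
      obtain ⟨t, h1, h2, h3, h4⟩ := H.late_act hunb s0 k
      refine ⟨t, ?_⟩
      have := H.cs j t h3 h4
      simp only [Bool.and_eq_true, decide_eq_true_eq]
      omega)
  obtain ⟨m, hm⟩ := pow_unbounded_of_one_lt (2 * B + 2) (by norm_num : (1 : ℚ) < 2)
  refine ⟨fun k => A (T (k + m)), hA.comp (hT.comp (RatComp.nadd Computable.id (Computable.const m))), fun k => ?_⟩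
  have h := hT2 (k + m)
  simp only [Bool.and_eq_true, decide_eq_true_eq] at h
  obtain ⟨⟨h1, h2⟩, h3⟩ := h
  have h4 : act (T (k + m)) ∧ Jq (T (k + m)) = j := by
    by_contra hcon
    rw [H.cn j _ hcon] at h3
    omega
  have h5 := hclose (k + m) _ (by omega) (by omega) h4.1 h4.2
  have h6 := hle (T (k + m))
  rw [abs_sub_comm, abs_of_nonneg (by linarith)]
  refine lt_of_le_of_lt h5 ?_
  have h7 : (2 * B + 2) * 2⁻¹ ^ (k + m) < (2⁻¹ : ℚ) ^ k := by
    rw [pow_add]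
    have h8 : (2⁻¹ : ℚ) ^ m * 2 ^ m = 1 := by rw [← mul_pow]; norm_num
    have h9 : (0 : ℚ) < 2⁻¹ ^ m := by positivity
    have h10 : (0 : ℚ) < 2⁻¹ ^ k := by positivity
    have h11 : (2 * B + 2) * 2⁻¹ ^ m < 1 := by
      rw [← h8, mul_comm]
      exact mul_lt_mul_of_pos_left hm h9
    nlinarith
  have h12 := (Rat.cast_lt (K := ℝ)).2 h7
  push_cast at h12 ⊢
  exact h12

theorem odd_case (H : Hist c l act) (hW : Monotone W)
    (hbn : ∀ s, ¬ act s → b (s + 1) = b s)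
    (hba : ∀ s, act s → b (s + 1) = b s + inc1 W (Jq s) (c (Jq s) s) (l (Jq s) s))
    (hGc : Computable₂ G) (hG : ∀ e, Monotone (G e))
    (hact : ∀ s, act s → |E1 (Jq s) (b s) (A s) - G (Jq s / 2) s| < 2⁻¹ ^ c (Jq s) s)
    {α β ω : ℝ} (hα : Tendsto (fun n => (A n : ℝ)) atTop (nhds α))
    (hb : Computable b) (hβ : Tendsto (fun n => (b n : ℝ)) atTop (nhds β))
    (hWc : Computable W) (hω : Tendsto (fun n => (W n : ℝ)) atTop (nhds ω))
    {j : ℕ} (hcj : Computable (c j)) (hj : j % 2 ≠ 0) {s0 : ℕ} (hs0 : ∀ s, s0 ≤ s → l j s = l j s0)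
    (hunb : ∀ B, ∃ s, B < c j s) : LeftCE (α - ((2⁻¹ ^ (j + l j s0) : ℚ) : ℝ) * ω) := by
  have hGr : Monotone (fun n => (G (j / 2) n : ℝ)) := fun x y h => by
    have := hG (j / 2) h
    simpa using this
  have hGlim : Tendsto (fun n => (G (j / 2) n : ℝ)) atTop (nhds (α - β)) := by
    refine tendsto_of_close hGr (hα.sub hβ) (fun n ε hε => ?_)
    obtain ⟨k, hk⟩ := exists_pow_lt_of_lt_one hε (by norm_num : (2⁻¹ : ℝ) < 1)
    obtain ⟨t, h1, h2, h3, h4⟩ := H.late_act hunb n k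
    refine ⟨t, h1, ?_⟩
    have h5 := hact t h3
    rw [h4, E1, if_neg hj] at h5
    have h6 : (2⁻¹ : ℚ) ^ c j t ≤ 2⁻¹ ^ k := pow_le_pow_of_le_one (by norm_num) (by norm_num) h2
    have h7 := h5.trans_le h6
    have h8 : |(A t : ℝ) - b t - G (j / 2) t| < 2⁻¹ ^ k := by
      have h9 := (Rat.cast_lt (K := ℝ)).2 h7
      push_cast at h9
      exact h9
    exact h8.trans hk
  have hctop : Tendsto (c j) atTop atTop :=
    tendsto_atTop_atTop_of_monotone (H.c_mono j) (fun B => (hunb B).imp (fun _ h => h.le))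
  have hsh : Tendsto (fun s : ℕ => s + s0) atTop atTop := tendsto_add_atTop_nat s0
  have hidc : Computable (fun s : ℕ => s + s0) := RatComp.nadd Computable.id (Computable.const s0)
  have hfc : Computable (fun s : ℕ => b (s + s0) - 2⁻¹ ^ (j + l j s0) * W (c j (s + s0)) + G (j / 2) (s + s0)) :=
    RatComp.add (RatComp.sub (hb.comp hidc) (RatComp.mul (Computable.const _) (hWc.comp (hcj.comp hidc))))
      (hGc.comp (Computable.const (j / 2)) hidc)
  refine leftCE_of_mono hfc ?_ ?_
  · refine monotone_nat_of_le_succ (fun s => ?_)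
    have e : s + 1 + s0 = (s + s0) + 1 := by ring
    rw [e]
    have hr : s0 ≤ s + s0 := by omega
    generalize s + s0 = r at hr
    have g1 := hG (j / 2) (Nat.le_succ r)
    rw [Nat.succ_eq_add_one] at g1
    by_cases ha : act r
    · rcases (H.no_lower hs0 hr ha).eq_or_lt with h | h
      · rw [hba r ha, ← h, inc1, if_neg hj, hs0 r hr, H.cs j r ha h.symm]
        linarith
      · rw [hba r ha, H.cn j r (by omega)]
        have := inc1_nonneg hW (Jq r) (c (Jq r) r) (l (Jq r) r)
        linarith
    · rw [hbn r ha, H.cn j r (by tauto)]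
      linarith
  · have h1 := ((hβ.comp hsh).sub (((hω.comp hctop).comp hsh).const_mul ((2⁻¹ ^ (j + l j s0) : ℚ) : ℝ))).add (hGlim.comp hsh)
    have e : β - ((2⁻¹ ^ (j + l j s0) : ℚ) : ℝ) * ω + (α - β) = α - ((2⁻¹ ^ (j + l j s0) : ℚ) : ℝ) * ω := by ring
    rw [e] at h1
    refine h1.congr (fun s => ?_)
    simp only [Function.comp]
    push_cast
    rfl

end

def dx1 (W : ℕ → ℚ) (j : ℕ) (h : List ℕ) : ℚ := inc1 W j (cnt h j) (ltc h j)
def dy1 (_ : ℕ) (_ : List ℕ) : ℚ := 0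

def cond1 (A : ℕ → ℚ) (G : ℕ → ℕ → ℚ) (s : ℕ) (p : St) : Bool :=
  (decide (E1 (Jq s) p.1.1 (A s) - G (Jq s / 2) s < 2⁻¹ ^ cnt p.2 (Jq s))) &&
    decide (G (Jq s / 2) s - E1 (Jq s) p.1.1 (A s) < 2⁻¹ ^ cnt p.2 (Jq s))

theorem comp_dx1 {W : ℕ → ℚ} (hW : Computable W) : Computable₂ (dx1 W) := by
  have hc : Computable (fun y : ℕ × List ℕ => cnt y.2 y.1) := comp_cnt.comp Computable.snd Computable.fst
  have hl : Computable (fun y : ℕ × List ℕ => ltc y.2 y.1) := comp_ltc.comp Computable.snd Computable.fst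
  have : Computable (fun y : ℕ × List ℕ => if y.1 % 2 = 0 then 0 else
      2⁻¹ ^ (y.1 + ltc y.2 y.1) * (W (cnt y.2 y.1 + 1) - W (cnt y.2 y.1))) :=
    RatComp.ite (comp_even Computable.fst) (Computable.const 0)
      (RatComp.mul (half_pow (RatComp.nadd Computable.fst hl))
        (RatComp.sub (hW.comp (Computable.succ.comp hc)) (hW.comp hc)))
  exact this

theorem comp_dy1 : Computable₂ dy1 := by
  have : Computable (fun _ : ℕ × List ℕ => (0 : ℚ)) := Computable.const 0
  exact this

theorem comp_cond1 {A : ℕ → ℚ} (hA : Computable A) {G : ℕ → ℕ → ℚ} (hG : Computable₂ G) :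
    Computable₂ (cond1 A G) := by
  have hJ : Computable (fun y : ℕ × St => Jq y.1) := comp_Jq.comp Computable.fst
  have hx : Computable (fun y : ℕ × St => y.2.1.1) := Computable.fst.comp (Computable.fst.comp Computable.snd)
  have hy : Computable (fun y : ℕ × St => A y.1) := hA.comp Computable.fst
  have hE : Computable (fun y : ℕ × St => E1 (Jq y.1) y.2.1.1 (A y.1)) :=
    RatComp.ite (comp_even hJ) (RatComp.sub hx hy) (RatComp.sub hy hx)
  have hg : Computable (fun y : ℕ × St => G (Jq y.1 / 2) y.1) := hG.comp (comp_half hJ) Computable.fst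
  have ha : Computable (fun y : ℕ × St => (2⁻¹ : ℚ) ^ cnt y.2.2 (Jq y.1)) :=
    half_pow (comp_cnt.comp (Computable.snd.comp Computable.snd) hJ)
  have := Primrec.and.to_comp.comp (RatComp.ltd (RatComp.sub hE hg) ha) (RatComp.ltd (RatComp.sub hg hE) ha)
  exact this.of_eq (fun _ => rfl)

theorem lemma1 {α ω : ℝ} (hα : LeftCE α) (hnc : ¬ ComputableReal α) (hω : LeftCE ω)
    (hno : ∀ m : ℕ, ¬ LeftCE (α - ((2⁻¹ ^ m : ℚ) : ℝ) * ω)) :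
    ∃ β : ℝ, LeftCE β ∧ ¬ LeftCE (α - β) ∧ ¬ LeftCE (β - α) := by
  obtain ⟨G, hG, hGm, hGe⟩ := exists_enum
  obtain ⟨A, hA, hAm, hAl⟩ := hα
  obtain ⟨W, hW, hWm, hWl⟩ := hω
  have hAm := hAm.monotone
  have hWm := hWm.monotone
  obtain ⟨B, hB⟩ : ∃ B : ℚ, ∀ i, W i - W 0 ≤ B := by
    obtain ⟨B, hB⟩ := exists_rat_gt (ω - W 0)
    refine ⟨B, fun i => ?_⟩
    have hm : Monotone (fun n => (W n : ℝ)) := fun a b h => by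
      have := hWm h
      simpa using this
    have h1 := hm.ge_of_tendsto hWl i
    have h2 : ((W i - W 0 : ℚ) : ℝ) ≤ B := by push_cast; linarith
    exact_mod_cast h2
  have hcomp := comp_stE (comp_dx1 hW) comp_dy1 (comp_cond1 hA hG)
  have H := hist_stE (dx1 W) dy1 (cond1 A G)
  have hact := fun s => stE_act (dx := dx1 W) (dy := dy1) (cond := cond1 A G) (s := s)
  have hnact := fun s => stE_nact (dx := dx1 W) (dy := dy1) (cond := cond1 A G) (s := s)
  generalize stE (dx1 W) dy1 (cond1 A G) = st at hcomp H hact hnact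
  have hX : Computable (fun s => (st s).1.1) := Computable.fst.comp (Computable.fst.comp hcomp)
  have hcj : ∀ j, Computable (fun s => cnt (st s).2 j) := fun j =>
    comp_cnt.comp (Computable.snd.comp hcomp) (Computable.const j)
  have hc1 : ∀ s, cond1 A G s (st s) = true ↔
      |E1 (Jq s) (st s).1.1 (A s) - G (Jq s / 2) s| < 2⁻¹ ^ cnt (st s).2 (Jq s) := by
    intro s
    simp only [cond1, Bool.and_eq_true, decide_eq_true_eq, abs_lt]
    constructor
    · rintro ⟨h1, h2⟩; constructor <;> linarith
    · rintro ⟨h1, h2⟩; constructor <;> linarith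
  have hbn : ∀ s, ¬ cond1 A G s (st s) = true → (st (s + 1)).1.1 = (st s).1.1 := fun s h => by rw [hnact s h]
  have hba : ∀ s, cond1 A G s (st s) = true → (st (s + 1)).1.1 = (st s).1.1 +
      inc1 W (Jq s) (cnt (st s).2 (Jq s)) (ltc (st s).2 (Jq s)) := fun s h => by rw [hact s h, dx1]
  have hXm : Monotone (fun s => (st s).1.1) := by
    refine monotone_nat_of_le_succ (fun s => ?_)
    by_cases ha : cond1 A G s (st s) = true
    · rw [hba s ha]
      have := inc1_nonneg hWm (Jq s) (cnt (st s).2 (Jq s)) (ltc (st s).2 (Jq s))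
      linarith
    · rw [hbn s ha]
  obtain ⟨β, hβ⟩ := exists_lim hXm (B := (st 0).1.1 + 2 * B) (fun s => by
    have := H.bound (b := fun s => (st s).1.1) hWm hB hbn (n := 0) (t := 0) (fun r _ har => by
      rw [hba r har, add_sub_cancel_left]
      exact inc1_le hWm (fun _ => Nat.zero_le _)) (Nat.zero_le s)
    simp only [pow_zero, one_mul] at this
    linarith)
  have hlb : ∀ j, ∃ K, ∀ s, ltc (st s).2 j ≤ K := by
    intro j
    induction j with
    | zero => exact ⟨0, fun s => (H.l_zero s).le⟩
    | succ j ih =>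
      obtain ⟨K, hK⟩ := ih
      obtain ⟨s0, hs0⟩ := eventually_const (H.l_mono j) hK
      by_cases hunb : ∀ B, ∃ s, B < cnt (st s).2 j
      · exfalso
        by_cases hj : j % 2 = 0
        · exact hnc (even_case (b := fun s => (st s).1.1) H hWm hB hbn hba hGm (fun s h => (hc1 s).1 h) hA hAm hAl
            (hcj j) hj hs0 hunb)
        · exact hno _ (odd_case (b := fun s => (st s).1.1) H hWm hbn hba hG hGm (fun s h => (hc1 s).1 h) hAl
            hX hβ hW hWl (hcj j) hj hs0 hunb)
      · push Not at hunb
        obtain ⟨K', hK'⟩ := hunb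
        refine ⟨K + K', fun s => ?_⟩
        have h1 := H.l_succ j s
        have h2 := hK s
        have h3 := hK' s
        omega
  have key : ∀ j, ∀ z : ℝ, Tendsto (fun s => ((E1 j (st s).1.1 (A s) : ℚ) : ℝ)) atTop (nhds z) →
      Tendsto (fun s => (G (j / 2) s : ℝ)) atTop (nhds z) → False := by
    intro j z h1 h2
    obtain ⟨K, hK⟩ := hlb (j + 1)
    have hK2 : ∀ s, cnt (st s).2 j ≤ K := fun s => (H.c_le_l (Nat.lt_succ_self j) s).trans (hK s)
    have h3 := h1.sub h2
    rw [sub_self] at h3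
    obtain ⟨n, hn⟩ := Metric.tendsto_atTop.1 h3 ((2⁻¹ : ℝ) ^ K) (by positivity)
    obtain ⟨m, hm, hj, hna⟩ := H.no_act hK2 n
    apply hna
    rw [hc1 m, hj]
    have h4 := hn m hm
    rw [Real.dist_eq, sub_zero] at h4
    have h5 : |E1 j (st m).1.1 (A m) - G (j / 2) m| < 2⁻¹ ^ K := by
      refine (Rat.cast_lt (K := ℝ)).1 ?_
      push_cast
      exact h4
    exact h5.trans_le (pow_le_pow_of_le_one (by norm_num) (by norm_num) (hK2 m))
  refine ⟨β, leftCE_of_mono hX hXm hβ, fun h => ?_, fun h => ?_⟩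
  · obtain ⟨e, he⟩ := hGe _ h
    refine key (2 * e + 1) _ ?_ (by rw [show (2 * e + 1) / 2 = e by omega]; exact he)
    refine (hAl.sub hβ).congr (fun s => ?_)
    have : (2 * e + 1) % 2 ≠ 0 := by omega
    simp [E1]
  · obtain ⟨e, he⟩ := hGe _ h
    refine key (2 * e) _ ?_ (by rw [Nat.mul_div_cancel_left _ (by norm_num)]; exact he)
    refine (hβ.sub hAl).congr (fun s => ?_)
    simp [E1]

theorem exists_incomparable (α : ℝ) (hα : LeftCE α) (hnc : ¬ ComputableReal α) :
    ∃ β : ℝ, LeftCE β ∧ ¬ LeftCE (α - β) ∧ ¬ LeftCE (β - α) := by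
  by_cases hcase : ∃ ω : ℝ, LeftCE ω ∧ ∀ m : ℕ, ¬ LeftCE (α - ((2⁻¹ ^ m : ℚ) : ℝ) * ω)
  · obtain ⟨ω, hω, hno⟩ := hcase
    exact lemma1 hα hnc hω hno
  · push Not at hcase
    obtain ⟨δ, β, hδ, hβ, h1, h2⟩ := lemma2
    obtain ⟨m, hm⟩ := hcase δ hδ
    have hmul : (2 : ℝ) ^ m * 2⁻¹ ^ m = 1 := by rw [← mul_pow]; norm_num
    refine ⟨(α - ((2⁻¹ ^ m : ℚ) : ℝ) * δ) + ((2⁻¹ ^ m : ℚ) : ℝ) * β, hm.add (hβ.smul (by positivity)), fun h => h1 ?_, fun h => h2 ?_⟩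
    · have := h.smul (q := 2 ^ m) (by positivity)
      convert this using 1
      push_cast
      linear_combination (β - δ) * hmul
    · have := h.smul (q := 2 ^ m) (by positivity)
      convert this using 1
      push_cast
      linear_combination (δ - β) * hmul

theorem statement0 (α : ℝ) (hα : LeftCE α) (hnc : ¬ ComputableReal α) :
    ∃ β : ℝ, LeftCE β ∧
      ∀ γ γ' : ℝ, LeftCE γ → RightCE γ' → α ≠ β + γ ∧ α ≠ β + γ' := by
  obtain ⟨β, hβ, h1, h2⟩ := exists_incomparable α hα hnc
  refine ⟨β, hβ, fun γ γ' hγ hγ' => ⟨fun h => h1 ?_, fun h => h2 ?_⟩⟩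
  · have e : α - β = γ := by rw [h]; ring
    rw [e]
    exact hγ
  · have e : β - α = -γ' := by rw [h]; ring
    rw [e]
    exact hγ'.neg
end

section
/- Suppose α and β have increasing computable rational approximations (α_s) and (β_s) such that α − α_s < q·(β − β_s) for all s, for some positive rational q. Then for every rational p > q there exists an increasing computable rational approximation (γ_s) converging to α such that γ_{s+1} − γ_s < p·(β_{s+1} − β_s) for all s. -/
open Filter

open Encodable

/-- The underlying (non-surjective) code of a rational. -/
def ratCode (x : ℚ) : ℕ := @encode ℚ Rat.instEncodable x

theorem ratCode_eq (x : ℚ) : ratCode x = Nat.pair (encode x.num) x.den := by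
  cases x; rfl

theorem int_code_ofNat (n : ℕ) : encode (n : ℤ) = 2 * n := rfl

theorem int_code_negSucc (n : ℕ) : encode (Int.negSucc n) = 2 * n + 1 := rfl

theorem int_code_natAbs (z : ℤ) : (encode z + 1) / 2 = z.natAbs := by
  cases z with
  | ofNat n => simp only [Int.ofNat_eq_natCast, int_code_ofNat, Int.natAbs_natCast]; omega
  | negSucc n => rw [int_code_negSucc, Int.natAbs_negSucc]; omega

theorem int_code_bodd (z : ℤ) : Nat.bodd (encode z) = decide (z < 0) := by
  cases z with
  | ofNat n => simp [int_code_ofNat]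
  | negSucc n => simp [int_code_negSucc]

/-- Recognizer of codes. -/
def IsRatCode (n : ℕ) : Prop :=
  0 < n.unpair.2 ∧ ∀ d < n.unpair.2 + 1,
    ((n.unpair.1 + 1) / 2 % d = 0 ∧ n.unpair.2 % d = 0) → d = 1

theorem isRatCode_iff (n : ℕ) : IsRatCode n ↔ n ∈ Set.range ratCode := by
  have key : IsRatCode n ↔ 0 < n.unpair.2 ∧ ((n.unpair.1 + 1) / 2).Coprime n.unpair.2 := by
    unfold IsRatCode
    refine and_congr_right fun hpos => ?_
    constructor
    · intro h
      refine h _ (Nat.lt_succ_of_le (Nat.le_of_dvd hpos (Nat.gcd_dvd_right _ _))) ⟨?_, ?_⟩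
      · exact Nat.mod_eq_zero_of_dvd (Nat.gcd_dvd_left _ _)
      · exact Nat.mod_eq_zero_of_dvd (Nat.gcd_dvd_right _ _)
    · rintro h d - ⟨h1, h2⟩
      exact Nat.eq_one_of_dvd_coprimes h (Nat.dvd_of_mod_eq_zero h1) (Nat.dvd_of_mod_eq_zero h2)
  rw [key]
  constructor
  · rintro ⟨h1, h2⟩
    have hz : encode (Denumerable.ofNat ℤ n.unpair.1) = n.unpair.1 := Denumerable.encode_ofNat _
    refine ⟨⟨Denumerable.ofNat ℤ n.unpair.1, n.unpair.2, h1.ne', ?_⟩, ?_⟩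
    · rw [← int_code_natAbs, hz]; exact h2
    · rw [ratCode_eq]
      simp only [hz, Nat.pair_unpair]
  · rintro ⟨x, rfl⟩
    rw [ratCode_eq]
    simp only [Nat.unpair_pair, int_code_natAbs]
    exact ⟨x.den_pos, x.reduced⟩

theorem primrec_isRatCode : PrimrecPred IsRatCode := by
  have h1 : Primrec fun n : ℕ => n.unpair.1 := Primrec.fst.comp Primrec.unpair
  have h2 : Primrec fun n : ℕ => n.unpair.2 := Primrec.snd.comp Primrec.unpair
  have hR : PrimrecRel (fun d n : ℕ =>
      ¬ (((n.unpair.1 + 1) / 2 % d = 0 ∧ n.unpair.2 % d = 0)) ∨ d = 1) := by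
    refine PrimrecPred.or (PrimrecPred.not (PrimrecPred.and ?_ ?_)) ?_
    · exact Primrec.eq.comp (Primrec.nat_mod.comp (Primrec.nat_div.comp
        (Primrec.succ.comp (h1.comp Primrec.snd)) (Primrec.const 2)) Primrec.fst) (Primrec.const 0)
    · exact Primrec.eq.comp (Primrec.nat_mod.comp (h2.comp Primrec.snd) Primrec.fst)
        (Primrec.const 0)
    · exact Primrec.eq.comp Primrec.fst (Primrec.const 1)
  have hA := hR.forall_lt.comp (Primrec.succ.comp h2) Primrec.id
  refine ((Primrec.nat_lt.comp (Primrec.const 0) h2).and hA).of_eq fun n => ?_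
  simp only [IsRatCode, ← imp_iff_not_or]
  rfl

theorem ratCode_injective : Function.Injective ratCode :=
  @encode_injective ℚ Rat.instEncodable

noncomputable instance : DecidablePred IsRatCode := Classical.decPred _

theorem rat_encode_eq (x : ℚ) :
    @encode ℚ Primcodable.toEncodable x = Nat.count IsRatCode (ratCode x) := by
  have h : @encode ℚ Primcodable.toEncodable x = (List.range (ratCode x)).countP
     (fun n => @decide (n ∈ Set.range (@encode ℚ Rat.instEncodable))
      (@decidableRangeEncode ℚ Rat.instEncodable n)) := rfl
  rw [h, Nat.count]
  congr 1
  funext n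
  rw [decide_eq_decide]
  exact (isRatCode_iff n).symm

theorem primrec_count : Primrec (Nat.count IsRatCode) := by
  have := Primrec.nat_rec₁ (f := fun n c => if IsRatCode n then c + 1 else c) 0
    (Primrec.ite (primrec_isRatCode.comp Primrec.fst) (Primrec.succ.comp Primrec.snd) Primrec.snd)
  refine this.of_eq fun n => ?_
  induction n with
  | zero => simp
  | succ n ih => rw [Nat.count_succ, ← ih]; split_ifs <;> simp [*]

theorem computable_of_graph {γ : Type*} [Primcodable γ] (f : γ → ℕ) (r : γ → ℕ → Bool)
    (hr : Computable₂ r) (h : ∀ a n, r a n = true ↔ n = f a) : Computable f := by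
  have hp : Partrec₂ fun a n => (Part.some (r a n) : Part Bool) := hr.partrec₂
  refine (Partrec.rfind hp).of_eq_tot fun a => ?_
  refine Nat.mem_rfind.2 ⟨by simpa using! ((h a (f a)).2 rfl).symm, fun {m} hm => ?_⟩
  have : r a m = false := by
    rw [← Bool.not_eq_true, h]; exact hm.ne
  simp [this]

theorem computable_rat_of_graph {γ : Type*} [Primcodable γ] (f : γ → ℚ) (r : γ → ℚ → Bool)
    (hr : Computable₂ r) (h : ∀ a n, r a n = true ↔ n = f a) : Computable f := by
  refine Computable.encode_iff.1 (computable_of_graph _ (fun a n => r a (Denumerable.ofNat ℚ n))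
    (hr.comp Computable.fst ((Computable.ofNat ℚ).comp Computable.snd)) fun a n => ?_)
  rw [h]
  constructor
  · intro h; rw [← h, Denumerable.encode_ofNat]
  · intro h; rw [h, Denumerable.ofNat_encode]

theorem computable_ratCode : Computable ratCode := by
  have h1 : PrimrecRel fun (x : ℚ) (n : ℕ) => IsRatCode n ∧ Nat.count IsRatCode n = @encode ℚ Primcodable.toEncodable x :=
    (primrec_isRatCode.comp Primrec.snd).and
      (Primrec.eq.comp (primrec_count.comp Primrec.snd) (Primrec.encode.comp Primrec.fst))
  obtain ⟨_, h2⟩ := h1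
  refine computable_of_graph _ _ h2.to_comp.to₂ fun x n => ?_
  simp only [decide_eq_true_eq]
  have hx : IsRatCode (ratCode x) := (isRatCode_iff _).2 ⟨x, rfl⟩
  rw [rat_encode_eq]
  constructor
  · rintro ⟨h, h'⟩
    exact Nat.count_injective h hx h'
  · rintro rfl
    exact ⟨hx, rfl⟩

/-- positive part of numerator -/
def rP (x : ℚ) : ℕ := x.num.toNat
/-- negative part of numerator -/
def rM (x : ℚ) : ℕ := (-x.num).toNat

theorem computable_den : Computable (fun x : ℚ => x.den) :=
  (Computable.snd.comp (Computable.unpair.comp computable_ratCode)).of_eq fun x => by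
    simp [ratCode_eq]

theorem computable_encnum : Computable (fun x : ℚ => encode x.num) :=
  (Computable.fst.comp (Computable.unpair.comp computable_ratCode)).of_eq fun x => by
    simp [ratCode_eq]

theorem computable_abs : Computable (fun x : ℚ => x.num.natAbs) :=
  ((Primrec.nat_div.to_comp.comp (Computable.succ.comp computable_encnum)
    (Computable.const 2))).of_eq fun _ => int_code_natAbs _

theorem computable_neg : Computable (fun x : ℚ => decide (x.num < 0)) :=
  (Computable.nat_bodd.comp computable_encnum).of_eq fun _ => int_code_bodd _

theorem computable_rP : Computable rP :=
  (Computable.cond computable_neg (Computable.const 0) computable_abs).of_eq fun x => by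
    unfold rP
    by_cases h : x.num < 0 <;> simp [h] <;> omega

theorem computable_rM : Computable rM :=
  (Computable.cond computable_neg computable_abs (Computable.const 0)).of_eq fun x => by
    unfold rM
    by_cases h : x.num < 0 <;> simp [h] <;> omega

theorem rat_repr (x : ℚ) : x = ((rP x : ℚ) - rM x) / x.den := by
  have h : (x.num : ℤ) = (rP x : ℤ) - rM x := by unfold rP rM; omega
  have h' : (x.num : ℚ) = (rP x : ℚ) - rM x := by rw [h]; push_cast; ring
  rw [← h', Rat.num_div_den]

theorem den_posQ (x : ℚ) : (0 : ℚ) < x.den := by exact_mod_cast x.den_pos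

section comb
variable {γ : Type*} [Primcodable γ]

theorem cadd {f g : γ → ℕ} (hf : Computable f) (hg : Computable g) :
    Computable fun a => f a + g a := Primrec.nat_add.to_comp.comp hf hg

theorem cmul {f g : γ → ℕ} (hf : Computable f) (hg : Computable g) :
    Computable fun a => f a * g a := Primrec.nat_mul.to_comp.comp hf hg

theorem ceq {f g : γ → ℕ} (hf : Computable f) (hg : Computable g) :
    Computable fun a => decide (f a = g a) := by
  have h : PrimrecRel (fun a b : ℕ => a = b) := Primrec.eq
  exact (h.decide.to_comp.comp hf hg)

theorem cle {f g : γ → ℕ} (hf : Computable f) (hg : Computable g) :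
    Computable fun a => decide (f a ≤ g a) :=
  (Primrec.nat_le.decide.to_comp.comp hf hg)

variable {f g : γ → ℚ}

theorem rat_le (hf : Computable f) (hg : Computable g) :
    Computable fun a => decide (f a ≤ g a) := by
  have P {h : γ → ℚ} (hh : Computable h) := computable_rP.comp hh
  have M {h : γ → ℚ} (hh : Computable h) := computable_rM.comp hh
  have D {h : γ → ℚ} (hh : Computable h) := computable_den.comp hh
  refine (cle (cadd (cmul (P hf) (D hg)) (cmul (M hg) (D hf)))
    (cadd (cmul (P hg) (D hf)) (cmul (M hf) (D hg)))).of_eq fun a => ?_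
  rw [decide_eq_decide]
  conv_rhs => rw [rat_repr (f a), rat_repr (g a), div_le_div_iff₀ (den_posQ _) (den_posQ _)]
  rw [← Nat.cast_le (α := ℚ)]
  push_cast
  constructor <;> intro h <;> linarith

theorem rat_min (hf : Computable f) (hg : Computable g) :
    Computable fun a => min (f a) (g a) :=
  (Computable.cond (rat_le hf hg) hf hg).of_eq fun a => by
    by_cases h : f a ≤ g a
    · simp [h]
    · simp [h, (not_le.1 h).le]

theorem rat_add (hf : Computable f) (hg : Computable g) :
    Computable fun a => f a + g a := by
  have X : Computable fun p : γ × ℚ => f p.1 := hf.comp Computable.fst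
  have Y : Computable fun p : γ × ℚ => g p.1 := hg.comp Computable.fst
  have Z : Computable fun p : γ × ℚ => p.2 := Computable.snd
  have P {h : γ × ℚ → ℚ} (hh : Computable h) := computable_rP.comp hh
  have M {h : γ × ℚ → ℚ} (hh : Computable h) := computable_rM.comp hh
  have D {h : γ × ℚ → ℚ} (hh : Computable h) := computable_den.comp hh
  have := ceq (cadd (cadd (cmul (cmul (P Z) (D X)) (D Y)) (cmul (cmul (M X) (D Y)) (D Z)))
      (cmul (cmul (M Y) (D X)) (D Z)))
    (cadd (cadd (cmul (cmul (M Z) (D X)) (D Y)) (cmul (cmul (P X) (D Y)) (D Z)))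
      (cmul (cmul (P Y) (D X)) (D Z)))
  refine computable_rat_of_graph _ _ this.to₂ fun a z => ?_
  rw [decide_eq_true_eq]
  conv_rhs => rw [rat_repr (f a), rat_repr (g a), rat_repr z,
    div_add_div _ _ (den_posQ _).ne' (den_posQ _).ne',
    div_eq_div_iff (den_posQ _).ne' (mul_pos (den_posQ _) (den_posQ _)).ne']
  rw [← Nat.cast_inj (R := ℚ)]
  push_cast
  constructor <;> intro h <;> linarith

theorem rat_mul (hf : Computable f) (hg : Computable g) :
    Computable fun a => f a * g a := by
  have X : Computable fun p : γ × ℚ => f p.1 := hf.comp Computable.fst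
  have Y : Computable fun p : γ × ℚ => g p.1 := hg.comp Computable.fst
  have Z : Computable fun p : γ × ℚ => p.2 := Computable.snd
  have P {h : γ × ℚ → ℚ} (hh : Computable h) := computable_rP.comp hh
  have M {h : γ × ℚ → ℚ} (hh : Computable h) := computable_rM.comp hh
  have D {h : γ × ℚ → ℚ} (hh : Computable h) := computable_den.comp hh
  have := ceq (cadd (cmul (cmul (P Z) (D X)) (D Y))
      (cmul (cadd (cmul (P X) (M Y)) (cmul (M X) (P Y))) (D Z)))
    (cadd (cmul (cmul (M Z) (D X)) (D Y))
      (cmul (cadd (cmul (P X) (P Y)) (cmul (M X) (M Y))) (D Z)))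
  refine computable_rat_of_graph _ _ this.to₂ fun a z => ?_
  rw [decide_eq_true_eq]
  conv_rhs => rw [rat_repr (f a), rat_repr (g a), rat_repr z, div_mul_div_comm,
    div_eq_div_iff (den_posQ _).ne' (mul_pos (den_posQ _) (den_posQ _)).ne']
  rw [← Nat.cast_inj (R := ℚ)]
  push_cast
  constructor <;> intro h <;> linarith

end comb

/-- running minimum -/
def runMin (e : ℕ → ℚ) (s : ℕ) : ℚ := Nat.rec (e 0) (fun n m => min m (e (n + 1))) s

theorem computable_runMin {e : ℕ → ℚ} (he : Computable e) : Computable (runMin e) :=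
  Computable.nat_rec (f := fun s : ℕ => s) (g := fun _ => e 0)
    (h := fun _ p => min p.2 (e (p.1 + 1))) Computable.id (Computable.const _)
    (rat_min (Computable.snd.comp Computable.snd)
      (he.comp (Computable.succ.comp (Computable.fst.comp Computable.snd)))).to₂

theorem runMin_succ (e : ℕ → ℚ) (s : ℕ) : runMin e (s + 1) = min (runMin e s) (e (s + 1)) := rfl

theorem runMin_le (e : ℕ → ℚ) (s : ℕ) : runMin e s ≤ e s := by
  cases s with
  | zero => exact le_rfl
  | succ n => exact min_le_right _ _

theorem le_runMin (e : ℕ → ℚ) (l : ℝ) (h : ∀ s, l ≤ e s) (s : ℕ) : l ≤ runMin e s := by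
  induction s with
  | zero => exact h 0
  | succ n ih => rw [runMin_succ, Rat.cast_min]; exact le_min ih (h _)

theorem statement8 (a b : ℕ → ℚ) (α β : ℝ) (q p : ℚ) (hq : 0 < q) (hpq : q < p)
    (ha : Computable a) (hb : Computable b)
    (hma : StrictMono a) (hmb : StrictMono b)
    (hta : Tendsto (fun s => (a s : ℝ)) atTop (nhds α))
    (htb : Tendsto (fun s => (b s : ℝ)) atTop (nhds β))
    (hbound : ∀ s, α - (a s : ℝ) < (q : ℝ) * (β - (b s : ℝ))) :
    ∃ c : ℕ → ℚ, Computable c ∧ StrictMono c ∧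
      Tendsto (fun s => (c s : ℝ)) atTop (nhds α) ∧
      ∀ s, c (s + 1) - c s < p * (b (s + 1) - b s) := by
  let e : ℕ → ℚ := fun s => a s + (-q) * b s
  have hee : ∀ s, e s = a s + (-q) * b s := fun _ => rfl
  have he : Computable e := rat_add ha (rat_mul (Computable.const (-q)) hb)
  refine ⟨fun s => q * b s + runMin e s,
    rat_add (rat_mul (Computable.const q) hb) (computable_runMin he), ?_, ?_, ?_⟩
  · refine strictMono_nat_of_lt_succ fun s => ?_
    have h1 := hma (Nat.lt_succ_self s)
    have h2 := mul_lt_mul_of_pos_left (hmb (Nat.lt_succ_self s)) hq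
    have h3 := runMin_le e s
    have h4 : runMin e s - q * (b (s + 1) - b s) < runMin e (s + 1) := by
      rw [runMin_succ, lt_min_iff, hee]
      rw [hee] at h3
      simp only [Nat.succ_eq_add_one] at h1 h2
      constructor <;> linarith
    show q * b s + runMin e s < q * b (s + 1) + runMin e (s + 1)
    linarith
  · have hl : Tendsto (fun s => (e s : ℝ)) atTop (nhds (α + (-q : ℝ) * β)) := by
      have := hta.add (htb.const_mul (-q : ℝ))
      simpa [hee] using! this
    have hm : Tendsto (fun s => (runMin e s : ℝ)) atTop (nhds (α + (-q : ℝ) * β)) := by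
      refine tendsto_of_tendsto_of_tendsto_of_le_of_le tendsto_const_nhds hl
        (fun s => ?_) (fun s => Rat.cast_le.2 (runMin_le e s))
      refine le_runMin e _ (fun s => ?_) s
      have := hbound s
      rw [hee]; push_cast
      linarith
    have := (htb.const_mul (q : ℝ)).add hm
    have h0 : (q : ℝ) * β + (α + (-q : ℝ) * β) = α := by ring
    rw [h0] at this
    refine this.congr fun s => ?_
    push_cast; ring
  · intro s
    have h1 := mul_lt_mul_of_pos_right hpq (sub_pos.2 (hmb (Nat.lt_succ_self s)))
    have h2 : runMin e (s + 1) ≤ runMin e s := min_le_left _ _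
    simp only [Nat.succ_eq_add_one] at h1
    show q * b (s + 1) + runMin e (s + 1) - (q * b s + runMin e s) < _
    linarith
end
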